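/- arXiv:1012.3235 — 4 statements merged into one kernel-verified Lean document; each statement's English description precedes it below -/
import Mathlib

section
/- Let P be a d-polytope, x ∈ P, and suppose K' is a simplicial subdivision of the antistar Ast_P(x) (the complex of faces of P not containing the smallest face containing x). Then {x ∗ σ : σ ∈ K'} is a simplicial subdivision of P. -/
/-- The cone of feasible directions of a convex set `P` at a point `y` of `P`. -/
def feasibleCone {E : Type*} [AddCommGroup E] [Module ℝ E] {P : Set E} (hP : Convex ℝ P)
    {y : E} (hy : y ∈ P) : PointedCone ℝ E where
  carrier := {w | ∃ ε : ℝ, 0 < ε ∧ y + ε • w ∈ P}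
  zero_mem' := ⟨1, one_pos, by simpa using hy⟩
  add_mem' := by
    rintro v w ⟨a, ha, hav⟩ ⟨b, hb, hbw⟩
    refine ⟨a * b / (a + b), by positivity, ?_⟩
    have hab : a + b ≠ 0 := by positivity
    convert hP hav hbw (a := b / (a + b)) (b := a / (a + b)) (by positivity) (by positivity)
      (by field_simp; ring) using 1
    match_scalars <;> field_simp
    ring
  smul_mem' := by
    rintro ⟨c, hc⟩ w ⟨a, ha, haw⟩
    rcases hc.eq_or_lt with rfl | hc'
    · refine ⟨1, one_pos, ?_⟩
      rw [Nonneg.mk_smul]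
      simpa using hy
    · refine ⟨a / c, by positivity, ?_⟩
      rw [Nonneg.mk_smul, smul_smul, div_mul_cancel₀ _ hc'.ne']
      exact haw

section FeasibleCone

variable {E : Type*} [AddCommGroup E] [Module ℝ E] {P : Set E} (hP : Convex ℝ P)
  {y : E} (hy : y ∈ P)

theorem mem_feasibleCone {w : E} :
    w ∈ feasibleCone hP hy ↔ ∃ ε : ℝ, 0 < ε ∧ y + ε • w ∈ P := Iff.rfl

theorem sub_mem_feasibleCone {z : E} (hz : z ∈ P) : z - y ∈ feasibleCone hP hy :=
  ⟨1, one_pos, by simpa using hz⟩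

theorem convex_setOf_sub_notMem_feasibleCone :
    Convex ℝ {z ∈ P | y - z ∉ feasibleCone hP hy} := by
  refine convex_iff_forall_pos.2 fun a ha b hb α β hα hβ hαβ => ?_
  refine ⟨hP ha.1 hb.1 hα.le hβ.le hαβ, fun h => ha.2 ?_⟩
  have h₁ := (feasibleCone hP hy).smul_mem hβ.le
    (sub_mem_feasibleCone hP hy hb.1)
  have h₂ := (feasibleCone hP hy).smul_mem (inv_pos.2 hα).le
    (add_mem h h₁)
  convert h₂ using 1
  obtain rfl : β = 1 - α := by linarith
  match_scalars <;> field_simp <;> ring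

end FeasibleCone

section Polytope

variable {E : Type*} [NormedAddCommGroup E] [NormedSpace ℝ E]

/-- If `y` is the last point of a polytope on the ray from `z` through `y`, some exposed face
contains `y` but not `z`. -/
theorem exists_isExposed_mem_notMem (s : Finset E) {y z : E}
    (hy : y ∈ convexHull ℝ (s : Set E)) (hz : z ∈ convexHull ℝ (s : Set E))
    (hyz : ∀ ε : ℝ, 0 < ε → y + ε • (y - z) ∉ convexHull ℝ (s : Set E)) :
    ∃ D : Set E, IsExposed ℝ (convexHull ℝ (s : Set E)) D ∧ y ∈ D ∧ z ∉ D := by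
  set P := convexHull ℝ (s : Set E) with hPdef
  have hP : Convex ℝ P := convex_convexHull ℝ _
  set T := feasibleCone hP hy
  have hsP : (s : Set E) ⊆ P := subset_convexHull ℝ _
  let A : Set E := {a ∈ (s : Set E) | y - a ∈ T}
  let B : Set E := {a ∈ (s : Set E) | y - a ∉ T}
  have hA : A.Finite := s.finite_toSet.subset (Set.sep_subset _ _)
  have hB : B.Finite := s.finite_toSet.subset (Set.sep_subset _ _)
  let W : Submodule ℝ E := Submodule.span ℝ ((fun a => a - y) '' A)
  have : FiniteDimensional ℝ W := FiniteDimensional.span_of_finite ℝ (hA.image _)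
  have hWT : W ≤ T.lineal := by
    refine Submodule.span_le.2 ?_
    rintro _ ⟨a, ha, rfl⟩
    exact ⟨sub_mem_feasibleCone hP hy (hsP ha.1), by simpa using ha.2⟩
  have hBT : convexHull ℝ B ⊆ {z ∈ P | y - z ∉ T} :=
    convexHull_min (fun b hb => ⟨hsP hb.1, hb.2⟩) (convex_setOf_sub_notMem_feasibleCone hP hy)
  have hclosed : IsClosed ((fun p => p - y) ⁻¹' (W : Set E)) :=
    W.closed_of_finiteDimensional.preimage (by fun_prop)
  have hconv : Convex ℝ ((fun p => p - y) ⁻¹' (W : Set E)) := by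
    simpa [sub_eq_add_neg] using W.convex.translate_preimage_left (-y)
  have hdisj : Disjoint (convexHull ℝ B) ((fun p => p - y) ⁻¹' (W : Set E)) := by
    refine Set.disjoint_left.2 fun p hp hpW => (hBT hp).2 ?_
    simpa using (hWT hpW).2
  obtain ⟨l, u, v, hlu, huv, hvl⟩ := geometric_hahn_banach_compact_closed
    (convex_convexHull ℝ B) (hB.isCompact_convexHull ℝ) hconv hclosed hdisj
  have hvy : v < l y := hvl y (by simp)
  have hlW : ∀ w ∈ W, l w = 0 := by
    intro w hw
    by_contra hne
    have h := hvl (y + ((v - l y) / l w) • w) (by simpa using W.smul_mem _ hw)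
    rw [map_add, map_smul, smul_eq_mul, div_mul_cancel₀ _ hne] at h
    linarith
  have hmax : P ⊆ {p | l p ≤ l y ∧ (l p = l y → p - y ∈ W)} := by
    refine convexHull_min ?_ ?_
    · intro a ha
      by_cases haT : y - a ∈ T
      · have haW : a - y ∈ W := Submodule.subset_span ⟨a, ⟨ha, haT⟩, rfl⟩
        have := hlW _ haW
        rw [map_sub] at this
        exact ⟨by linarith, fun _ => haW⟩
      · have := hlu a (subset_convexHull ℝ _ ⟨ha, haT⟩)
        exact ⟨by linarith, fun h => by linarith⟩
    · refine convex_iff_forall_pos.2 fun a ha b hb α β hα hβ hαβ => ?_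
      have e : l (α • a + β • b) - l y = α * (l a - l y) + β * (l b - l y) := by
        simp only [map_add, map_smul, smul_eq_mul]
        linear_combination (l y) * hαβ
      have h₁ := mul_nonneg hα.le (sub_nonneg.2 ha.1)
      have h₂ := mul_nonneg hβ.le (sub_nonneg.2 hb.1)
      refine ⟨by linarith, fun h => ?_⟩
      have ha' : α * (l y - l a) = 0 := by linarith
      have hb' : β * (l y - l b) = 0 := by linarith
      rw [mul_eq_zero, or_iff_right hα.ne'] at ha'
      rw [mul_eq_zero, or_iff_right hβ.ne'] at hb'
      have haW := W.smul_mem α (ha.2 (by linarith))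
      have hbW := W.smul_mem β (hb.2 (by linarith))
      convert W.add_mem haW hbW using 1
      obtain rfl : β = 1 - α := by linarith
      module
  refine ⟨l.toExposed P, ContinuousLinearMap.toExposed.isExposed,
    ⟨hy, fun p hp => (hmax hp).1⟩, fun hzD => ?_⟩
  have hzW := (hmax hz).2 (le_antisymm (hmax hz).1 (hzD.2 y hy))
  obtain ⟨ε, hε, h⟩ := (hWT hzW).2
  exact hyz ε hε (by simpa using h)

/-- Every point `p ≠ x` of a polytope lies on a segment from `x` to an exposed face that does not
contain `x`. -/
theorem exists_isExposed_mem_segment (s : Finset E) {x p : E}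
    (hx : x ∈ convexHull ℝ (s : Set E)) (hp : p ∈ convexHull ℝ (s : Set E)) (hpx : p ≠ x) :
    ∃ D : Set E, IsExposed ℝ (convexHull ℝ (s : Set E)) D ∧ x ∉ D ∧
      ∃ y ∈ D, p ∈ segment ℝ x y := by
  have hcomp : IsCompact (convexHull ℝ (s : Set E)) := s.finite_toSet.isCompact_convexHull ℝ
  set P := convexHull ℝ (s : Set E) with hPdef
  let S : Set ℝ := {t | x + t • (p - x) ∈ P}
  have hS : IsClosed S := hcomp.isClosed.preimage (by fun_prop)
  have h1 : (1 : ℝ) ∈ S := by simpa [S] using hp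
  have hpos : 0 < ‖p - x‖ := norm_pos_iff.2 (sub_ne_zero.2 hpx)
  have hbdd : BddAbove S := by
    obtain ⟨R, hR⟩ := hcomp.isBounded.subset_closedBall x
    refine ⟨R / ‖p - x‖, fun t ht => ?_⟩
    have h := hR ht
    rw [Metric.mem_closedBall, dist_eq_norm, add_sub_cancel_left, norm_smul] at h
    rw [le_div_iff₀ hpos]
    exact (mul_le_mul_of_nonneg_right (le_abs_self t) hpos.le).trans h
  have hmem : sSup S ∈ S := hS.csSup_mem ⟨1, h1⟩ hbdd
  have h1t : 1 ≤ sSup S := le_csSup hbdd h1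
  set t := sSup S
  obtain ⟨D, hD, hyD, hxD⟩ := exists_isExposed_mem_notMem s (y := x + t • (p - x)) hmem hx
    (fun ε hε h => by
      have hle : t + ε * t ≤ t := by
        refine le_csSup hbdd ?_
        change x + (t + ε * t) • (p - x) ∈ P
        convert h using 1
        module
      nlinarith)
  refine ⟨D, hD, hxD, _, hyD, ?_⟩
  rw [segment_eq_image']
  refine ⟨t⁻¹, ⟨by positivity, inv_le_one_of_one_le₀ h1t⟩, ?_⟩
  simp [smul_smul, inv_mul_cancel₀ (by positivity : t ≠ 0)]

/-- A point outside an exposed set is not in the affine span of any of its subsets. -/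
theorem IsExposed.notMem_affineSpan {P D t : Set E} {x : E} (hD : IsExposed ℝ P D)
    (hx : x ∈ P) (hxD : x ∉ D) (ht : t ⊆ D) : x ∉ affineSpan ℝ t := by
  intro h
  obtain ⟨d, hd⟩ := (affineSpan_nonempty ℝ).1 ⟨x, h⟩
  obtain ⟨l, rfl⟩ := hD ⟨d, ht hd⟩
  have hl : l x = l d := by
    refine affineSpan_induction h (p := fun z => l z = l d)
      (fun z hz => le_antisymm ((ht hd).2 z (ht hz).1) ((ht hz).2 d (ht hd).1)) ?_
    intro c u v w hu hv hw
    simp [hu, hv, hw]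
  exact hxD ⟨hx, fun y hy => hl ▸ (ht hd).2 y hy⟩

end Polytope

section Join

variable {E : Type*} [AddCommGroup E] [Module ℝ E]

theorem AffineIndependent.insert_of_notMem_affineSpan {x : E} {t : Set E}
    (ht : AffineIndependent ℝ (Subtype.val : t → E)) (hx : x ∉ affineSpan ℝ t) :
    AffineIndependent ℝ (Subtype.val : ↥(insert x t : Set E) → E) := by
  have hxt : ∀ y : (insert x t : Set E), y ≠ ⟨x, Set.mem_insert x t⟩ → (y : E) ∈ t :=
    fun y hy => y.2.resolve_left fun h => hy (Subtype.ext h)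
  refine AffineIndependent.affineIndependent_of_notMem_span
    (i := (⟨x, Set.mem_insert x t⟩ : (insert x t : Set E))) ?_ ?_
  · let f : {y : (insert x t : Set E) // y ≠ ⟨x, Set.mem_insert x t⟩} ↪ t :=
      ⟨fun y => ⟨y.1, hxt y.1 y.2⟩,
        fun a b h => Subtype.ext (Subtype.ext (congrArg (fun c : t => (c : E)) h))⟩
    exact ht.comp_embedding f
  · refine fun h => hx (affineSpan_mono ℝ ?_ h)
    rintro _ ⟨y, hy, rfl⟩
    exact hxt y hy

theorem IsExtreme.mem_convexHull_of_mem_convexHull_insert {P D w : Set E} {x p : E}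
    (hP : Convex ℝ P) (hD : IsExtreme ℝ P D) (hx : x ∈ P) (hxD : x ∉ D) (hw : w ⊆ P)
    (hpD : p ∈ D) (hp : p ∈ convexHull ℝ (insert x w)) : p ∈ convexHull ℝ w := by
  rcases w.eq_empty_or_nonempty with rfl | hne
  · rw [insert_empty_eq, convexHull_singleton, Set.mem_singleton_iff] at hp
    exact absurd (hp ▸ hpD) hxD
  · rw [convexHull_insert hne, convexJoin_singleton_left, Set.mem_iUnion₂] at hp
    obtain ⟨q, hq, hpq⟩ := hp
    rcases eq_or_ne q p with rfl | hqp
    · exact hq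
    · have hxp : x ≠ p := fun h => hxD (h ▸ hpD)
      exact absurd (hD.left_mem_of_mem_openSegment hx (convexHull_min hw hP hq) hpD
        (mem_openSegment_of_ne_left_right hxp hqp hpq)) hxD

theorem IsExtreme.le_of_add_smul_eq {P D : Set E} {x q r : E} {a b : ℝ}
    (hD : IsExtreme ℝ P D) (hx : x ∈ P) (hxD : x ∉ D) (hq : q ∈ P) (hr : r ∈ D) (ha : 0 < a)
    (h : x + a • (q - x) = x + b • (r - x)) : b ≤ a := by
  by_contra! hab
  have hb : 0 < b := ha.trans hab
  refine hxD (hD.left_mem_of_mem_openSegment hx hq hr ?_)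
  rw [openSegment_eq_image']
  refine ⟨a / b, ⟨by positivity, (div_lt_one hb).2 hab⟩, ?_⟩
  change x + (a / b) • (q - x) = r
  rw [div_eq_inv_mul, mul_smul, add_left_cancel h, inv_smul_smul₀ hb.ne', add_sub_cancel]

theorem convexHull_insert_inter_convexHull_insert_subset {P D₁ D₂ t u : Set E} {x : E}
    (hD₁ : IsExtreme ℝ P D₁) (hD₂ : IsExtreme ℝ P D₂) (hx : x ∈ P)
    (hx₁ : x ∉ D₁) (hx₂ : x ∉ D₂) (ht : convexHull ℝ t ⊆ D₁) (hu : convexHull ℝ u ⊆ D₂)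
    (htu : convexHull ℝ t ∩ convexHull ℝ u ⊆ convexHull ℝ (t ∩ u)) :
    convexHull ℝ (insert x t) ∩ convexHull ℝ (insert x u) ⊆
      convexHull ℝ (insert x (t ∩ u)) := by
  rintro p ⟨hpt, hpu⟩
  have hxm : x ∈ convexHull ℝ (insert x (t ∩ u)) :=
    subset_convexHull ℝ _ (Set.mem_insert _ _)
  by_cases hpx : p = x
  · exact hpx ▸ hxm
  have hne : ∀ {w : Set E}, p ∈ convexHull ℝ (insert x w) → w.Nonempty := by
    intro w hw
    by_contra! hemp
    rw [hemp, insert_empty_eq, convexHull_singleton] at hw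
    exact hpx hw
  rw [convexHull_insert (hne hpt), convexJoin_singleton_left, Set.mem_iUnion₂] at hpt
  rw [convexHull_insert (hne hpu), convexJoin_singleton_left, Set.mem_iUnion₂] at hpu
  obtain ⟨q, hq, hpq⟩ := hpt
  obtain ⟨r, hr, hpr⟩ := hpu
  have hseg := hpq
  rw [segment_eq_image'] at hpq hpr
  obtain ⟨a, ⟨ha, -⟩, hpa⟩ := hpq
  obtain ⟨b, ⟨hb, -⟩, hpb⟩ := hpr
  simp only at hpa hpb
  have ha' : 0 < a := ha.lt_of_ne fun h => hpx (by rw [← hpa, ← h, zero_smul, add_zero])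
  have hb' : 0 < b := hb.lt_of_ne fun h => hpx (by rw [← hpb, ← h, zero_smul, add_zero])
  have hab : a = b := le_antisymm
    (hD₁.le_of_add_smul_eq hx hx₁ (hD₂.subset (hu hr)) (ht hq) hb' (hpb.trans hpa.symm))
    (hD₂.le_of_add_smul_eq hx hx₂ (hD₁.subset (ht hq)) (hu hr) ha' (hpa.trans hpb.symm))
  have hqr : q = r := by
    have h := add_left_cancel (hpa.trans hpb.symm)
    rw [hab] at h
    exact sub_left_injective (smul_right_injective E hb'.ne' h)
  refine (convex_convexHull ℝ _).segment_subset hxm ?_ hseg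
  exact convexHull_mono (Set.subset_insert _ _) (htu ⟨hq, hqr ▸ hr⟩)

end Join


/-- The antistar lemma, simplicial version: let `P` be a polytope, `x ∈ P`, and `C` the
smallest face of `P` containing `x`.  If `K'` is a simplicial subdivision of the antistar of
`x` in `P` (the complex of faces of `P` not containing `C`), then coning with apex `x` yields a
simplicial subdivision of `P`. -/
theorem antistar_simplicial_subdivision {E : Type*} [NormedAddCommGroup E] [NormedSpace ℝ E]
    [DecidableEq E]
    (s : Finset E) (P : Set E) (hP : P = convexHull ℝ (s : Set E))
    (x : E) (hx : x ∈ P)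
    (C : Set E) (hC : IsExposed ℝ P C) (hxC : x ∈ C)
    (hmin : ∀ F : Set E, IsExposed ℝ P F → x ∈ F → C ⊆ F)
    (K' : Geometry.SimplicialComplex ℝ E)
    (hspace : K'.space = ⋃ D ∈ {D : Set E | IsExposed ℝ P D ∧ ¬ C ⊆ D}, D)
    (hfine : ∀ t ∈ K'.faces, ∃ D : Set E, IsExposed ℝ P D ∧ ¬ C ⊆ D ∧ (t : Set E) ⊆ D) :
    ∃ K : Geometry.SimplicialComplex ℝ E,
      K.faces = K'.faces ∪ {{x}} ∪ {t | ∃ u ∈ K'.faces, t = insert x u} ∧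
      K.space = P := by
  have hPc : Convex ℝ P := hP ▸ convex_convexHull ℝ _
  have key : ∀ t : Finset E, t ∈ K'.faces ∨ t = ∅ →
      ∃ D : Set E, IsExposed ℝ P D ∧ x ∉ D ∧ (t : Set E) ⊆ D := by
    rintro t (ht | rfl)
    · obtain ⟨D, hD, hCD, htD⟩ := hfine t ht
      exact ⟨D, hD, fun hxD => hCD (hmin D hD hxD), htD⟩
    · exact ⟨∅, isExposed_empty, id, by simp⟩
  have hinter : ∀ t u : Finset E, t ∈ K'.faces ∨ t = ∅ → u ∈ K'.faces ∨ u = ∅ →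
      convexHull ℝ (t : Set E) ∩ convexHull ℝ (u : Set E) ⊆ convexHull ℝ (t ∩ u : Set E) := by
    rintro t u (ht | rfl) (hu | rfl)
    · exact K'.inter_subset_convexHull ht hu
    all_goals simp
  have hjoin : ∀ t u : Finset E, t ∈ K'.faces ∨ t = ∅ → u ∈ K'.faces ∨ u = ∅ →
      convexHull ℝ (insert x (t : Set E)) ∩ convexHull ℝ (insert x (u : Set E)) ⊆
        convexHull ℝ (insert x (t ∩ u : Set E)) := by
    intro t u ht hu
    obtain ⟨D₁, hD₁, hx₁, htD⟩ := key t ht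
    obtain ⟨D₂, hD₂, hx₂, huD⟩ := key u hu
    exact convexHull_insert_inter_convexHull_insert_subset hD₁.isExtreme hD₂.isExtreme hx hx₁
      hx₂ (convexHull_min htD (hD₁.convex hPc)) (convexHull_min huD (hD₂.convex hPc))
      (hinter t u ht hu)
  have hmixed : ∀ t u : Finset E, t ∈ K'.faces → u ∈ K'.faces ∨ u = ∅ →
      convexHull ℝ (t : Set E) ∩ convexHull ℝ (insert x (u : Set E)) ⊆
        convexHull ℝ (t ∩ u : Set E) := by
    rintro t u ht hu p ⟨hpt, hpu⟩
    obtain ⟨D, hD, hxD, htD⟩ := key t (Or.inl ht)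
    exact hD.isExtreme.mem_convexHull_of_mem_convexHull_insert hPc hx hxD
      (Set.inter_subset_left.trans (htD.trans hD.subset))
      (convexHull_min htD (hD.convex hPc) hpt)
      (hjoin t u (Or.inl ht) hu ⟨convexHull_mono (Set.subset_insert _ _) hpt, hpu⟩)
  have hfaces : ∀ t : Finset E, t ∈ K'.faces ∪ {{x}} ∪ {t | ∃ u ∈ K'.faces, t = insert x u} ↔
      t ∈ K'.faces ∨ ∃ u, (u ∈ K'.faces ∨ u = ∅) ∧ t = insert x u := by
    intro t
    simp only [Set.mem_union, Set.mem_singleton_iff, Set.mem_ofPred_eq, or_and_right, exists_or,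
      exists_eq_left, insert_empty_eq, or_assoc]
    rw [or_comm (a := t = {x})]
  refine ⟨{ faces := K'.faces ∪ {{x}} ∪ {t | ∃ u ∈ K'.faces, t = insert x u}
            isRelLowerSet_faces := ?_
            indep := ?_
            inter_subset_convexHull := ?_ }, rfl, ?_⟩
  · intro t ht
    rw [hfaces] at ht
    have hne : t.Nonempty := by
      rcases ht with ht | ⟨u, -, rfl⟩
      · exact K'.nonempty_of_mem_faces ht
      · exact Finset.insert_nonempty _ _
    refine ⟨hne, fun r hrt hr => ?_⟩
    change r ⊆ t at hrt
    rw [hfaces]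
    rcases ht with ht | ⟨u, hu, rfl⟩
    · exact Or.inl (K'.down_closed ht hrt hr)
    · have hsub : ∀ w : Finset E, w ⊆ u → w ∈ K'.faces ∨ w = ∅ := by
        intro w hw
        rcases w.eq_empty_or_nonempty with h | h
        · exact Or.inr h
        · refine Or.inl (K'.down_closed (hu.resolve_right ?_) hw h)
          rintro rfl
          exact h.ne_empty (Finset.subset_empty.1 hw)
      by_cases hxr : x ∈ r
      · exact Or.inr ⟨r.erase x, hsub _ (Finset.subset_insert_iff.1 hrt),
          (Finset.insert_erase hxr).symm⟩
      · exact Or.inl ((hsub r ((Finset.subset_insert_iff_of_notMem hxr).1 hrt)).resolve_right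
          hr.ne_empty)
  · intro t ht
    rw [hfaces] at ht
    rcases ht with ht | ⟨u, hu, rfl⟩
    · exact K'.indep ht
    · obtain ⟨D, hD, hxD, huD⟩ := key u hu
      have hui : AffineIndependent ℝ (Subtype.val : ↥(u : Set E) → E) := by
        rcases hu with hu | rfl
        · exact K'.indep hu
        · rw [Finset.coe_empty]
          exact affineIndependent_of_subsingleton ℝ _
      have h := hui.insert_of_notMem_affineSpan (hD.notMem_affineSpan hx hxD huD)
      rw [← Finset.coe_insert] at h
      exact h
  · intro t u ht hu
    rw [hfaces] at ht hu
    rcases ht with ht | ⟨t, ht, rfl⟩ <;> rcases hu with hu | ⟨u, hu, rfl⟩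
    · exact K'.inter_subset_convexHull ht hu
    · rw [Finset.coe_insert]
      exact (hmixed t u ht hu).trans
        (convexHull_mono (Set.inter_subset_inter_right _ (Set.subset_insert _ _)))
    · rw [Finset.coe_insert, Set.inter_comm, Set.inter_comm (insert x _)]
      exact (hmixed u t hu ht).trans
        (convexHull_mono (Set.inter_subset_inter_right _ (Set.subset_insert _ _)))
    · rw [Finset.coe_insert, Finset.coe_insert, ← Set.insert_inter_distrib]
      exact hjoin t u ht hu
  · refine Set.Subset.antisymm ?_ ?_
    · refine Set.iUnion₂_subset fun t ht => convexHull_min ?_ hPc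
      change t ∈ _ at ht
      rw [hfaces] at ht
      rcases ht with ht | ⟨u, hu, rfl⟩
      · obtain ⟨D, hD, -, htD⟩ := key t (Or.inl ht)
        exact htD.trans hD.subset
      · obtain ⟨D, hD, -, huD⟩ := key u hu
        rw [Finset.coe_insert]
        exact Set.insert_subset hx (huD.trans hD.subset)
    · intro p hp
      rw [Geometry.SimplicialComplex.mem_space_iff]
      by_cases hpx : p = x
      · exact ⟨{x}, Or.inl (Or.inr rfl), by simp [hpx]⟩
      · subst hP
        obtain ⟨D, hD, hxD, y, hyD, hpy⟩ := exists_isExposed_mem_segment s hx hp hpx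
        have hyK : y ∈ K'.space := by
          rw [hspace]
          exact Set.mem_biUnion (show D ∈ _ from ⟨hD, fun h => hxD (h hxC)⟩) hyD
        obtain ⟨u, hu, hyu⟩ := Geometry.SimplicialComplex.mem_space_iff.1 hyK
        refine ⟨insert x u, Or.inr ⟨u, hu, rfl⟩, ?_⟩
        rw [Finset.coe_insert]
        exact (convex_convexHull ℝ _).segment_subset
          (subset_convexHull ℝ _ (Set.mem_insert _ _))
          (convexHull_mono (Set.subset_insert _ _) hyu) hpy
end

section
/- Let α, β, γ be simplices in an affine space of dimensions i ≥ 1, j ≥ 1, k ≥ −1 respectively. Suppose the relative interiors of α and β intersect, and some (j−1)-face β_0 of β is such that the convex hull of γ ∪ α ∪ β_0 is an (i+j+k+1)-simplex. Then both the joins γ̄ ∗ ᾱ ∗ ∂β̄ and γ̄ ∗ ∂ᾱ ∗ β̄ are simplicial subdivisions of the convex hull ⟨γ ∪ α ∪ β⟩. -/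
open Finset in
/-- Membership in the convex hull of a subset `s` of a finite set `V`, expressed by weights on `V`
vanishing outside `s`. -/
theorem mem_convexHull_iff_of_subset {E : Type*} [AddCommGroup E] [Module ℝ E] [DecidableEq E]
    {s V : Finset E} (hsV : s ⊆ V) {x : E} :
    x ∈ convexHull ℝ (s : Set E) ↔ ∃ w : E → ℝ, (∀ v, 0 ≤ w v) ∧ (∀ v, v ∉ s → w v = 0) ∧
      ∑ v ∈ V, w v = 1 ∧ ∑ v ∈ V, w v • v = x := by
  rw [Finset.mem_convexHull']
  constructor
  · rintro ⟨w, h0, h1, hx⟩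
    refine ⟨fun v => if v ∈ s then w v else 0, fun v => ?_, fun v hv => by simp [hv], ?_, ?_⟩
    · dsimp only
      split_ifs with h
      exacts [h0 v h, le_rfl]
    · rw [← sum_subset hsV fun v _ hv => by simp [hv], ← h1]
      exact sum_congr rfl fun v hv => by simp [hv]
    · rw [← sum_subset hsV fun v _ hv => by simp [hv], ← hx]
      exact sum_congr rfl fun v hv => by simp [hv]
  · rintro ⟨w, h0, hs, h1, hx⟩
    refine ⟨w, fun v _ => h0 v, ?_, ?_⟩
    · rw [sum_subset hsV fun v _ hv => hs v hv, h1]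
    · rw [sum_subset hsV fun v _ hv => by simp [hs v hv], hx]

open Finset in
/-- A finite set is affinely independent if it carries no nontrivial affine dependence. -/
theorem affineIndependent_coe_of_forall {E : Type*} [AddCommGroup E] [Module ℝ E]
    [DecidableEq E] {s : Finset E}
    (h : ∀ w : E → ℝ, (∀ v, v ∉ s → w v = 0) → ∑ v ∈ s, w v = 0 → ∑ v ∈ s, w v • v = 0 →
      ∀ v ∈ s, w v = 0) :
    AffineIndependent ℝ ((↑) : s → E) := by
  rw [affineIndependent_iff]
  intro t w h0 h1 e he
  have hat : s.attach ∩ t = t := inter_eq_right.2 fun v _ => mem_attach s v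
  have key := h (fun v => if hv : v ∈ s then if (⟨v, hv⟩ : s) ∈ t then w ⟨v, hv⟩ else 0 else 0)
    (fun v hv => by simp [hv])
    (by
      rw [← sum_attach]
      simpa [sum_ite_mem, hat] using h0)
    (by
      rw [← sum_attach]
      simpa [sum_ite_mem, ite_smul, hat] using h1) e e.2
  simpa [he] using key

open Finset in
/-- A point of the relative interior of the convex hull of a finite set is a convex combination
with positive weights. -/
theorem exists_pos_weights_of_mem_intrinsicInterior_convexHull {E : Type*} [NormedAddCommGroup E]
    [NormedSpace ℝ E] [DecidableEq E] {A : Finset E} {p : E}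
    (hp : p ∈ intrinsicInterior ℝ (convexHull ℝ (A : Set E))) :
    ∃ w : E → ℝ, (∀ v ∈ A, 0 < w v) ∧ (∀ v, v ∉ A → w v = 0) ∧ ∑ v ∈ A, w v = 1 ∧
      ∑ v ∈ A, w v • v = p := by
  have hpA : p ∈ convexHull ℝ (A : Set E) := intrinsicInterior_subset hp
  have hne : A.Nonempty := by
    simpa using convexHull_nonempty_iff.1 ⟨p, hpA⟩
  have key : ∀ a ∈ A, ∃ w : E → ℝ, (∀ v, 0 ≤ w v) ∧ 0 < w a ∧ (∀ v, v ∉ A → w v = 0) ∧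
      ∑ v ∈ A, w v = 1 ∧ ∑ v ∈ A, w v • v = p := by
    intro a ha
    obtain ⟨y, hy, rfl⟩ := mem_intrinsicInterior.1 hp
    have haS : a ∈ affineSpan ℝ (convexHull ℝ (A : Set E)) :=
      subset_affineSpan ℝ _ (subset_convexHull ℝ _ ha)
    let f : ℝ → affineSpan ℝ (convexHull ℝ (A : Set E)) := fun t =>
      ⟨AffineMap.lineMap a (y : E) (1 + t), AffineMap.lineMap_mem _ haS y.2⟩
    have hf : Continuous f := by
      refine Continuous.subtype_mk ?_ _
      exact AffineMap.lineMap_continuous.comp (by fun_prop)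
    have hf0 : f 0 = y := by
      apply Subtype.ext
      simp [f]
    have hnhds : ∀ᶠ t in nhds (0 : ℝ), f t ∈ interior
        ((↑) ⁻¹' convexHull ℝ (A : Set E) : Set (affineSpan ℝ (convexHull ℝ (A : Set E)))) := by
      refine hf.continuousAt.eventually_mem ?_
      rw [hf0]
      exact isOpen_interior.mem_nhds hy
    obtain ⟨t, ht, htpos⟩ :=
      ((hnhds.filter_mono nhdsWithin_le_nhds).and
        (self_mem_nhdsWithin : Set.Ioi (0 : ℝ) ∈ nhdsWithin 0 (Set.Ioi 0))).exists
    have htpos : 0 < t := htpos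
    have hmem : AffineMap.lineMap a (y : E) (1 + t) ∈ convexHull ℝ (A : Set E) :=
      Set.mem_preimage.1 (interior_subset ht : f t ∈ _)
    obtain ⟨w, w0, wA, w1, wx⟩ := (mem_convexHull_iff_of_subset (Subset.refl A)).1 hmem
    have ht1 : (1 + t) ≠ 0 := by positivity
    refine ⟨fun v => (1 + t)⁻¹ * (w v + if v = a then t else 0), fun v => ?_, ?_, fun v hv => ?_,
      ?_, ?_⟩
    · have := w0 v
      dsimp only
      split_ifs <;> positivity
    · have := w0 a
      simp only [if_true]
      positivity
    · have : v ≠ a := fun h => hv (h ▸ ha)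
      simp [this, wA v hv]
    · rw [← mul_sum, sum_add_distrib, w1]
      simp [ha, ht1]
    · simp only [mul_smul, add_smul, ← smul_sum, sum_add_distrib, wx, ite_smul, zero_smul,
        sum_ite_eq', ha, if_true]
      rw [inv_smul_eq_iff₀ ht1, AffineMap.lineMap_apply_module]
      module
  choose! w w0 wpos wA w1 wx using key
  have hc : (A.card : ℝ) ≠ 0 := by simpa using hne.ne_empty
  have hc0 : (0 : ℝ) < A.card := by positivity
  refine ⟨fun v => (A.card : ℝ)⁻¹ * ∑ a ∈ A, w a v, fun v hv => ?_, fun v hv => ?_, ?_, ?_⟩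
  · exact mul_pos (inv_pos.2 hc0)
      (sum_pos' (fun a ha => w0 a ha v) ⟨v, hv, wpos v hv⟩)
  · dsimp only
    rw [sum_eq_zero fun a ha => wA a ha v hv, mul_zero]
  · rw [← mul_sum, sum_comm, sum_congr rfl w1]
    simp [hc]
  · simp only [mul_smul, sum_smul, ← smul_sum]
    rw [sum_comm, sum_congr rfl wx, inv_smul_eq_iff₀ hc]
    simp [Nat.cast_smul_eq_nsmul]

open Finset in
/-- If the affine dependences of a finite set `V` are the multiples of a single one, whose negative
part is supported exactly on `B`, then the subsets of `V` not containing `B` triangulate the convex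
hull of `V`. -/
theorem exists_simplicialComplex_of_circuit {E : Type*} [AddCommGroup E] [Module ℝ E]
    [DecidableEq E] {V B : Finset E} {l : E → ℝ} (hBV : B ⊆ V) (hB : B.Nonempty)
    (hneg : ∀ v ∈ B, l v < 0) (hnonneg : ∀ v, v ∉ B → 0 ≤ l v) (hl : ∑ v ∈ V, l v = 0)
    (hlv : ∑ v ∈ V, l v • v = 0)
    (huniq : ∀ m : E → ℝ, ∑ v ∈ V, m v = 0 → ∑ v ∈ V, m v • v = 0 →
      ∃ c : ℝ, ∀ v ∈ V, m v = c * l v) :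
    ∃ K : Geometry.SimplicialComplex ℝ E,
      K.faces = {s : Finset E | s.Nonempty ∧ s ⊆ V ∧ ¬ B ⊆ s} ∧
      K.space = convexHull ℝ (V : Set E) := by
  refine ⟨{ faces := {s : Finset E | s.Nonempty ∧ s ⊆ V ∧ ¬ B ⊆ s}
            isRelLowerSet_faces := fun s hs =>
              ⟨hs.1, fun t hts ht => ⟨ht, hts.trans hs.2.1, fun h => hs.2.2 (h.trans hts)⟩⟩
            indep := ?_
            inter_subset_convexHull := ?_ }, rfl, ?_⟩
  · rintro s ⟨-, hsV, hBs⟩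
    obtain ⟨b, hb, hbs⟩ := not_subset.1 hBs
    refine affineIndependent_coe_of_forall fun w ws h0 h1 v hv => ?_
    rw [sum_subset hsV fun v _ hv => ws v hv] at h0
    rw [sum_subset hsV fun v _ hv => by simp [ws v hv]] at h1
    obtain ⟨c, hc⟩ := huniq w h0 h1
    have hcb := hc b (hBV hb)
    rw [ws b hbs, eq_comm, mul_eq_zero, or_iff_left (hneg b hb).ne] at hcb
    rw [hc v (hsV hv), hcb, zero_mul]
  · rintro s t ⟨-, hsV, hBs⟩ ⟨-, htV, hBt⟩ x ⟨hxs, hxt⟩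
    obtain ⟨b, hb, hbs⟩ := not_subset.1 hBs
    obtain ⟨b', hb', hbt⟩ := not_subset.1 hBt
    obtain ⟨m, m0, ms, m1, mx⟩ := (mem_convexHull_iff_of_subset hsV).1 hxs
    obtain ⟨n, n0, nt, n1, nx⟩ := (mem_convexHull_iff_of_subset htV).1 hxt
    obtain ⟨c, hc⟩ := huniq (fun v => m v - n v) (by simp [m1, n1])
      (by simp [sub_smul, mx, nx])
    have hcb := hc b (hBV hb)
    have hcb' := hc b' (hBV hb')
    simp only [ms b hbs, nt b' hbt] at hcb hcb'
    have hc0 : c = 0 := by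
      apply le_antisymm
      · by_contra! h
        have := mul_neg_of_pos_of_neg h (hneg b' hb')
        linarith [m0 b']
      · by_contra! h
        have := mul_pos_of_neg_of_neg h (hneg b hb)
        linarith [n0 b]
    have hmn : ∀ v ∈ V, m v = n v := fun v hv => by
      have := hc v hv
      rw [hc0] at this
      linarith
    rw [← coe_inter, mem_convexHull_iff_of_subset (inter_subset_left.trans hsV)]
    refine ⟨m, m0, fun v hv => ?_, m1, mx⟩
    by_cases hvs : v ∈ s
    · rw [hmn v (hsV hvs)]
      exact nt v fun h => hv (mem_inter.2 ⟨hvs, h⟩)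
    · exact ms v hvs
  · ext x
    rw [Geometry.SimplicialComplex.mem_space_iff]
    constructor
    · rintro ⟨s, ⟨-, hsV, -⟩, hx⟩
      exact convexHull_mono (coe_subset.2 hsV) hx
    · intro hx
      obtain ⟨m, m0, mV, m1, mx⟩ := (mem_convexHull_iff_of_subset (Subset.refl V)).1 hx
      obtain ⟨b, hb, hmin⟩ := exists_min_image B (fun v => m v / -l v) hB
      have hlb : 0 < -l b := neg_pos.2 (hneg b hb)
      set r := m b / -l b with hr
      have hr0 : 0 ≤ r := div_nonneg (m0 b) hlb.le
      have hsV : V.erase b ⊆ V := erase_subset _ _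
      have hxs : x ∈ convexHull ℝ ((V.erase b : Finset E) : Set E) := by
        rw [mem_convexHull_iff_of_subset hsV]
        have hsum : ∑ v ∈ V, (m v + r * l v) = 1 := by
          rw [sum_add_distrib, ← mul_sum, hl, m1, mul_zero, add_zero]
        have hsumv : ∑ v ∈ V, (m v + r * l v) • v = x := by
          simp only [add_smul, mul_smul, sum_add_distrib, ← smul_sum, hlv, mx, smul_zero, add_zero]
        refine ⟨fun v => if v ∈ V then m v + r * l v else 0, fun v => ?_, fun v hv => ?_, ?_, ?_⟩
        · dsimp only
          split_ifs
          · by_cases hvB : v ∈ B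
            · have := hmin v hvB
              rw [le_div_iff₀ (neg_pos.2 (hneg v hvB))] at this
              linarith
            · exact add_nonneg (m0 v) (mul_nonneg hr0 (hnonneg v hvB))
          · exact le_rfl
        · dsimp only
          split_ifs with hvV
          · obtain rfl : v = b := by
              by_contra h
              exact hv (mem_erase.2 ⟨h, hvV⟩)
            rw [hr]
            field_simp [hlb.ne', (hneg v hb).ne]
            ring
          · rfl
        · rw [← hsum]
          exact sum_congr rfl fun v hv => by simp [hv]
        · rw [← hsumv]
          exact sum_congr rfl fun v hv => by simp [hv]
      refine ⟨V.erase b, ⟨?_, hsV, fun h => notMem_erase b V (h hb)⟩, hxs⟩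
      exact coe_nonempty.1 (convexHull_nonempty_iff.1 ⟨x, hxs⟩)


/-- Lemma on subdividing the hull of three simplices: let `α`, `β`, `γ` be simplices (given by
their affinely independent vertex sets `A`, `B`, `G`) of dimensions `i ≥ 1`, `j ≥ 1`, `k ≥ −1`
(`G` may be empty, i.e. `k = −1`).  Suppose the relative interiors of `α` and `β` meet, and
there is a `(j−1)`-face `β₀` of `β` (obtained by deleting a vertex `b` of `B`) such that
`⟨γ ∪ α ∪ β₀⟩` is an `(i+j+k+1)`-simplex.  Then both `γ̄ ∗ ᾱ ∗ ∂β̄` and `γ̄ ∗ ∂ᾱ ∗ β̄` are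
simplicial subdivisions of the convex hull `⟨γ ∪ α ∪ β⟩`. -/
theorem join_boundary_subdivisions {E : Type*} [NormedAddCommGroup E] [NormedSpace ℝ E]
    [DecidableEq E] (i j : ℕ) (hi : 1 ≤ i) (hj : 1 ≤ j)
    (A B G : Finset E)
    (hAcard : A.card = i + 1) (hBcard : B.card = j + 1)
    (hA : AffineIndependent ℝ ((↑) : A → E))
    (hB : AffineIndependent ℝ ((↑) : B → E))
    (hG : AffineIndependent ℝ ((↑) : G → E))
    (hint : (intrinsicInterior ℝ (convexHull ℝ (A : Set E)) ∩
      intrinsicInterior ℝ (convexHull ℝ (B : Set E))).Nonempty)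
    (hβ₀ : ∃ b ∈ B,
      AffineIndependent ℝ ((↑) : (G ∪ A ∪ B.erase b : Finset E) → E) ∧
      (G ∪ A ∪ B.erase b).card = G.card + A.card + B.card - 1) :
    (∃ K : Geometry.SimplicialComplex ℝ E,
      K.faces = {s : Finset E | s.Nonempty ∧
        ∃ g a b', g ⊆ G ∧ a ⊆ A ∧ b' ⊂ B ∧ s = g ∪ a ∪ b'} ∧
      K.space = convexHull ℝ ((G ∪ A ∪ B : Finset E) : Set E)) ∧
    (∃ K : Geometry.SimplicialComplex ℝ E,
      K.faces = {s : Finset E | s.Nonempty ∧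
        ∃ g a' b, g ⊆ G ∧ a' ⊂ A ∧ b ⊆ B ∧ s = g ∪ a' ∪ b} ∧
      K.space = convexHull ℝ ((G ∪ A ∪ B : Finset E) : Set E)) := by
  obtain ⟨p, hpA, hpB⟩ := hint
  obtain ⟨u, upos, uA, u1, up⟩ := exists_pos_weights_of_mem_intrinsicInterior_convexHull hpA
  obtain ⟨w, wpos, wB, w1, wp⟩ := exists_pos_weights_of_mem_intrinsicInterior_convexHull hpB
  obtain ⟨b, hb, hind, hcard⟩ := hβ₀
  have hAne : A.Nonempty := Finset.card_pos.1 (by omega)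
  have hBne : B.Nonempty := ⟨b, hb⟩
  have herase : (B.erase b).card = j := by rw [Finset.card_erase_of_mem hb]; omega
  have hunion := Finset.card_union_add_card_inter (G ∪ A) (B.erase b)
  have hunion' := Finset.card_union_add_card_inter G A
  have hGA : Disjoint G A :=
    Finset.disjoint_iff_inter_eq_empty.2 (Finset.card_eq_zero.1 (by omega))
  have hGAB : Disjoint (G ∪ A) (B.erase b) :=
    Finset.disjoint_iff_inter_eq_empty.2 (Finset.card_eq_zero.1 (by omega))
  set V := G ∪ A ∪ B with hV
  have hAV : A ⊆ V := fun v hv => by simp [hV, hv]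
  have hBV : B ⊆ V := fun v hv => by simp [hV, hv]
  have hl : ∑ v ∈ V, (u v - w v) = 0 := by
    rw [Finset.sum_sub_distrib, ← Finset.sum_subset hAV fun v _ hv => uA v hv,
      ← Finset.sum_subset hBV fun v _ hv => wB v hv, u1, w1, sub_self]
  have hlv : ∑ v ∈ V, (u v - w v) • v = 0 := by
    simp only [sub_smul, Finset.sum_sub_distrib]
    rw [← Finset.sum_subset hAV fun v _ hv => by simp [uA v hv],
      ← Finset.sum_subset hBV fun v _ hv => by simp [wB v hv], up, wp, sub_self]
  have hbGA : b ∉ G ∪ A := by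
    intro hbGA
    have hVe : G ∪ A ∪ B.erase b = V := by
      ext v
      by_cases hvb : v = b
      · subst hvb
        simp only [hV, Finset.mem_union] at hbGA ⊢
        tauto
      · simp [hV, hvb]
    rw [hVe] at hind
    obtain ⟨b', hb'⟩ := Finset.card_pos.1 (by omega : 0 < (B.erase b).card)
    have hb'B := Finset.mem_of_mem_erase hb'
    have hb'A : b' ∉ A := fun h =>
      Finset.disjoint_right.1 hGAB hb' (Finset.mem_union_right _ h)
    have := hind.eq_zero_of_sum_eq_zero_subtype hl hlv b' (hBV hb'B)
    rw [uA b' hb'A] at this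
    linarith [wpos b' hb'B]
  have hdisj : Disjoint (G ∪ A) B := by
    rw [← Finset.insert_erase hb, Finset.disjoint_insert_right]
    exact ⟨hbGA, hGAB⟩
  rw [Finset.disjoint_union_left] at hdisj
  obtain ⟨hGB, hAB⟩ := hdisj
  have hVe : V.erase b = G ∪ A ∪ B.erase b := by
    rw [hV, Finset.erase_union_distrib, Finset.erase_eq_of_notMem hbGA]
  have hlb : u b - w b < 0 := by
    rw [uA b (Finset.disjoint_right.1 hAB hb)]
    linarith [wpos b hb]
  have huniq : ∀ m : E → ℝ, ∑ v ∈ V, m v = 0 → ∑ v ∈ V, m v • v = 0 →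
      ∃ c : ℝ, ∀ v ∈ V, m v = c * (u v - w v) := by
    intro m hm hmv
    refine ⟨m b / (u b - w b), ?_⟩
    set c := m b / (u b - w b) with hc
    have hcb : m b - c * (u b - w b) = 0 := by
      rw [hc, div_mul_cancel₀ _ hlb.ne, sub_self]
    have h0 : ∑ v ∈ V, (m v - c * (u v - w v)) = 0 := by
      rw [Finset.sum_sub_distrib, ← Finset.mul_sum, hl, hm, mul_zero, sub_self]
    have h1 : ∑ v ∈ V, (m v - c * (u v - w v)) • v = 0 := by
      rw [Finset.sum_congr rfl fun v _ => by rw [sub_smul, mul_smul], Finset.sum_sub_distrib,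
        ← Finset.smul_sum, hlv, hmv, smul_zero, sub_self]
    rw [← Finset.sum_erase V hcb, hVe] at h0
    rw [← Finset.sum_erase V (a := b) (by rw [hcb, zero_smul]), hVe] at h1
    intro v hv
    by_cases hvb : v = b
    · rw [hvb]
      linarith
    · have := hind.eq_zero_of_sum_eq_zero_subtype h0 h1 v
        (hVe ▸ Finset.mem_erase.2 ⟨hvb, hv⟩)
      linarith
  have u0 : ∀ v, 0 ≤ u v := fun v => by
    by_cases h : v ∈ A
    exacts [(upos v h).le, (uA v h).ge]
  have w0 : ∀ v, 0 ≤ w v := fun v => by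
    by_cases h : v ∈ B
    exacts [(wpos v h).le, (wB v h).ge]
  have hfaceB : {s : Finset E | s.Nonempty ∧ ∃ g a b', g ⊆ G ∧ a ⊆ A ∧ b' ⊂ B ∧ s = g ∪ a ∪ b'} =
      {s : Finset E | s.Nonempty ∧ s ⊆ V ∧ ¬ B ⊆ s} := by
    ext s
    refine and_congr_right fun _ => ⟨?_, fun ⟨hsV, hBs⟩ => ?_⟩
    · rintro ⟨g, a, b', hg, ha, hb', rfl⟩
      refine ⟨Finset.union_subset_union (Finset.union_subset_union hg ha) hb'.1, fun h => ?_⟩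
      refine hb'.2 fun v hv => ?_
      have hvG : v ∉ g := fun h => Finset.disjoint_right.1 hGB hv (hg h)
      have hvA : v ∉ a := fun h => Finset.disjoint_right.1 hAB hv (ha h)
      simpa [hvG, hvA] using h hv
    · refine ⟨s ∩ G, s ∩ A, s ∩ B, Finset.inter_subset_right, Finset.inter_subset_right,
        ⟨Finset.inter_subset_right, fun h => hBs (h.trans Finset.inter_subset_left)⟩, ?_⟩
      rw [← Finset.inter_union_distrib_left, ← Finset.inter_union_distrib_left,
        Finset.inter_eq_left.2 hsV]
  have hfaceA : {s : Finset E | s.Nonempty ∧ ∃ g a' b, g ⊆ G ∧ a' ⊂ A ∧ b ⊆ B ∧ s = g ∪ a' ∪ b} =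
      {s : Finset E | s.Nonempty ∧ s ⊆ V ∧ ¬ A ⊆ s} := by
    ext s
    refine and_congr_right fun _ => ⟨?_, fun ⟨hsV, hAs⟩ => ?_⟩
    · rintro ⟨g, a', b', hg, ha, hb', rfl⟩
      refine ⟨Finset.union_subset_union (Finset.union_subset_union hg ha.1) hb', fun h => ?_⟩
      refine ha.2 fun v hv => ?_
      have hvG : v ∉ g := fun h => Finset.disjoint_right.1 hGA hv (hg h)
      have hvB : v ∉ b' := fun h => Finset.disjoint_left.1 hAB hv (hb' h)
      simpa [hvG, hvB] using h hv
    · refine ⟨s ∩ G, s ∩ A, s ∩ B, Finset.inter_subset_right,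
        ⟨Finset.inter_subset_right, fun h => hAs (h.trans Finset.inter_subset_left)⟩,
        Finset.inter_subset_right, ?_⟩
      rw [← Finset.inter_union_distrib_left, ← Finset.inter_union_distrib_left,
        Finset.inter_eq_left.2 hsV]
  rw [hfaceA, hfaceB]
  constructor
  · refine exists_simplicialComplex_of_circuit (l := fun v => u v - w v) hBV hBne
      (fun v hv => ?_) (fun v hv => ?_) hl hlv huniq
    · simpa [uA v (Finset.disjoint_right.1 hAB hv)] using wpos v hv
    · simpa [wB v hv] using u0 v
  · refine exists_simplicialComplex_of_circuit (l := fun v => -(u v - w v)) hAV hAne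
      (fun v hv => ?_) (fun v hv => ?_) ?_ ?_ fun m hm hmv => ?_
    · simpa [wB v (Finset.disjoint_left.1 hAB hv)] using upos v hv
    · simpa [uA v hv] using w0 v
    · rw [Finset.sum_neg_distrib, hl, neg_zero]
    · simp only [neg_smul, Finset.sum_neg_distrib, hlv, neg_zero]
    · obtain ⟨c, hc⟩ := huniq m hm hmv
      exact ⟨-c, fun v hv => by rw [hc v hv, neg_mul_neg]⟩
end

section
/- Let G be a group of simplicial automorphisms of a finite simplicial complex X, acting piecewise linearly on the geometric carrier |X|. The map |X|/G → |X/G| induced by the quotient simplicial map is a homeomorphism if and only if the G-action on X is pure. -/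
open scoped Classical

/-- `u` and `v` lie in a common orbit of the group `G` of permutations of the vertices. -/
def SameOrbit {V : Type*} (G : Subgroup (Equiv.Perm V)) (u v : V) : Prop :=
  ∃ g ∈ G, g u = v

/-- The action of `G` on the simplicial complex `X` is pure: (a) distinct vertices in a common
`G`-orbit are never adjacent; (b) for each `G`-orbit and each face `α`, the stabiliser of `α`
acts transitively on the orbit's vertices in the link of `α`. -/
def IsPureAction {V : Type*} [DecidableEq V] (G : Subgroup (Equiv.Perm V))
    (X : Set (Finset V)) : Prop :=
  (∀ u v : V, u ≠ v → SameOrbit G u v → ({u, v} : Finset V) ∉ X) ∧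
  (∀ α ∈ X, ∀ u v : V, SameOrbit G u v →
    u ∉ α → insert u α ∈ X → v ∉ α → insert v α ∈ X →
    ∃ g ∈ G, α.image g = α ∧ g u = v)

/-- The set of orbits of `G` on the vertices. -/
abbrev OrbitQuot {V : Type*} (G : Subgroup (Equiv.Perm V)) : Type _ :=
  Quot (SameOrbit G)

/-- The geometric carrier of an abstract simplicial complex with vertex set `W`, in the
standard realization sending the vertex `w` to the basis point `e_w` of `W → ℝ`. -/
def carrier {W : Type*} [DecidableEq W] (Y : Set (Finset W)) : Set (W → ℝ) :=
  ⋃ s ∈ Y, convexHull ℝ ((s.image fun w => (Pi.single w 1 : W → ℝ)) : Set (W → ℝ))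

/-- The piecewise-linear action of a vertex permutation on the geometric carrier. -/
def permAct {V : Type*} (g : Equiv.Perm V) (x : V → ℝ) : V → ℝ := x ∘ g.symm

/-- Two points of `|X|` are related iff they differ by the piecewise-linear action of an
element of `G`; the quotient `|X|/G` is `Quot` of this relation. -/
def carrierRel {V : Type*} [DecidableEq V] (G : Subgroup (Equiv.Perm V)) (X : Set (Finset V))
    (x y : {x : V → ℝ // x ∈ carrier X}) : Prop :=
  ∃ g ∈ G, permAct g x.val = y.val

/-- The quotient simplicial complex `X/G`, whose faces are the images of the faces of `X`
under the vertex quotient map. -/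
def quotComplex {V : Type*} [DecidableEq V] (G : Subgroup (Equiv.Perm V))
    (X : Set (Finset V)) : Set (Finset (OrbitQuot G)) :=
  {t | ∃ s ∈ X, t = s.image (Quot.mk (SameOrbit G))}

/-- The piecewise-linear extension `|q|` of the vertex quotient map `q : V → V/G`:
barycentric coordinates are summed over the fibres of `q`. -/
noncomputable def pushq {V : Type*} [Fintype V] (G : Subgroup (Equiv.Perm V)) (x : V → ℝ) :
    OrbitQuot G → ℝ :=
  fun t => ∑ v : V, if Quot.mk (SameOrbit G) v = t then x v else 0

theorem mem_carrier_iff {W : Type*} [DecidableEq W] {Y : Set (Finset W)} {x : W → ℝ} :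
    x ∈ carrier Y ↔ ∃ s ∈ Y, (∀ w, 0 ≤ x w) ∧ (∀ w, w ∉ s → x w = 0) ∧ ∑ w ∈ s, x w = 1 := by
  simp only [carrier, Set.mem_iUnion, exists_prop]
  refine exists_congr fun s => and_congr_right fun _ => ⟨fun hx => ?_, ?_⟩
  · have hconv : Convex ℝ {x : W → ℝ | (∀ w, 0 ≤ x w) ∧ (∀ w, w ∉ s → x w = 0) ∧
        ∑ w ∈ s, x w = 1} := by
      rintro x ⟨hx0, hxs, hx1⟩ y ⟨hy0, hys, hy1⟩ a b ha hb hab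
      refine ⟨fun w => ?_, fun w hw => ?_, ?_⟩
      · exact add_nonneg (mul_nonneg ha (hx0 w)) (mul_nonneg hb (hy0 w))
      · simp [hxs w hw, hys w hw]
      · simp [Finset.sum_add_distrib, ← Finset.mul_sum, hx1, hy1, hab]
    refine convexHull_min ?_ hconv hx
    intro z hz
    simp only [Finset.coe_image, Set.mem_image, Finset.mem_coe] at hz
    obtain ⟨v, hv, rfl⟩ := hz
    refine ⟨fun w => ?_, fun w hw => ?_, ?_⟩
    · exact (Pi.single_nonneg.2 zero_le_one : (0 : W → ℝ) ≤ Pi.single v 1) w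
    · exact Pi.single_eq_of_ne (M := fun _ => ℝ) (fun h : w = v => hw (h ▸ hv)) 1
    · simp [hv]
  · rintro ⟨hx0, hxs, hx1⟩
    have hx : x = ∑ w ∈ s, x w • (Pi.single w 1 : W → ℝ) := by
      ext v
      by_cases hv : v ∈ s <;> simp [Finset.sum_apply, Pi.single_apply, hv, hxs]
    rw [hx]
    refine (convex_convexHull ℝ _).sum_mem (fun w _ => hx0 w) hx1 fun w hw => ?_
    exact subset_convexHull ℝ _ (by simpa using ⟨w, hw, rfl⟩)

theorem exists_face_eq_support {W : Type*} [DecidableEq W] {Y : Set (Finset W)}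
    (hdown : ∀ s ∈ Y, ∀ t ⊆ s, t ∈ Y) {x : W → ℝ} (hx : x ∈ carrier Y) :
    ∃ s ∈ Y, (∀ w, 0 ≤ x w) ∧ ∀ w, w ∈ s ↔ x w ≠ 0 := by
  obtain ⟨s, hs, hx0, hxs, -⟩ := mem_carrier_iff.1 hx
  refine ⟨s.filter fun w => x w ≠ 0, hdown s hs _ (Finset.filter_subset _ _), hx0, fun w => ?_⟩
  simp only [Finset.mem_filter, and_iff_right_iff_imp]
  exact fun h => not_imp_comm.1 (hxs w) h

theorem isCompact_carrier {W : Type*} [Finite W] [DecidableEq W] (Y : Set (Finset W)) :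
    IsCompact (carrier Y) :=
  Y.toFinite.isCompact_biUnion fun s _ =>
    (Finset.finite_toSet (s.image fun w => (Pi.single w 1 : W → ℝ))).isCompact_convexHull (𝕜 := ℝ)

theorem permAct_mem_carrier {V : Type*} [DecidableEq V] {X : Set (Finset V)}
    {g : Equiv.Perm V} (hg : ∀ s ∈ X, s.image g ∈ X) {x : V → ℝ} (hx : x ∈ carrier X) :
    permAct g x ∈ carrier X := by
  obtain ⟨s, hs, hx0, hxs, hx1⟩ := mem_carrier_iff.1 hx
  refine mem_carrier_iff.2 ⟨_, hg s hs, fun w => hx0 _, fun w hw => hxs _ fun h => hw ?_, ?_⟩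
  · exact Finset.mem_image.2 ⟨_, h, g.apply_symm_apply w⟩
  · rw [Finset.sum_image g.injective.injOn]
    simpa [permAct] using hx1

theorem sameOrbit_equivalence {V : Type*} (G : Subgroup (Equiv.Perm V)) :
    Equivalence (SameOrbit G) where
  refl _ := ⟨1, G.one_mem, rfl⟩
  symm := by
    rintro _ _ ⟨g, hg, rfl⟩
    exact ⟨g⁻¹, G.inv_mem hg, g.symm_apply_apply _⟩
  trans := by
    rintro _ _ _ ⟨g, hg, rfl⟩ ⟨h, hh, rfl⟩
    exact ⟨h * g, G.mul_mem hh hg, rfl⟩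

theorem carrierRel_equivalence {V : Type*} [DecidableEq V] (G : Subgroup (Equiv.Perm V))
    (X : Set (Finset V)) : Equivalence (carrierRel G X) where
  refl _ := ⟨1, G.one_mem, rfl⟩
  symm := by
    rintro x y ⟨g, hg, h⟩
    refine ⟨g⁻¹, G.inv_mem hg, ?_⟩
    rw [← h]
    ext v
    exact congrArg x.val (g.symm_apply_apply v)
  trans := by
    rintro x y z ⟨g, hg, h⟩ ⟨k, hk, h'⟩
    refine ⟨k * g, G.mul_mem hk hg, ?_⟩
    rw [← h', ← h]
    rfl

theorem quot_mk_eq_iff_sameOrbit {V : Type*} {G : Subgroup (Equiv.Perm V)} {u v : V} :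
    Quot.mk (SameOrbit G) u = Quot.mk (SameOrbit G) v ↔ SameOrbit G u v :=
  (sameOrbit_equivalence G).quot_mk_eq_iff u v

/-- `pushq` as a linear map. -/
noncomputable def pushqLinear {V : Type*} [Fintype V] (G : Subgroup (Equiv.Perm V)) :
    (V → ℝ) →ₗ[ℝ] (OrbitQuot G → ℝ) where
  toFun := pushq G
  map_add' x y := by
    ext t
    simp only [pushq, Pi.add_apply, ← Finset.sum_add_distrib]
    exact Finset.sum_congr rfl fun v _ => by split_ifs <;> simp
  map_smul' c x := by
    ext t
    simp [pushq, Finset.mul_sum]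

theorem pushqLinear_apply {V : Type*} [Fintype V] (G : Subgroup (Equiv.Perm V)) (x : V → ℝ) :
    pushqLinear G x = pushq G x := rfl

theorem pushqLinear_single {V : Type*} [Fintype V] [DecidableEq V]
    (G : Subgroup (Equiv.Perm V)) (v : V) :
    pushqLinear G (Pi.single v 1) = Pi.single (Quot.mk (SameOrbit G) v) 1 := by
  ext t
  rw [pushqLinear_apply, pushq, Finset.sum_eq_single v]
  · simp [Pi.single_apply, eq_comm]
  · intro w _ hw
    simp [hw]
  · simp

theorem image_pushq_carrier {V : Type*} [Fintype V] [DecidableEq V]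
    (G : Subgroup (Equiv.Perm V)) (X : Set (Finset V)) :
    pushq G '' carrier X = carrier (quotComplex G X) := by
  change pushqLinear G '' carrier X = _
  have himage (s : Finset V) :
      pushqLinear G '' convexHull ℝ ((fun w => (Pi.single w 1 : V → ℝ)) '' s) =
        convexHull ℝ ((fun w => (Pi.single w 1 : OrbitQuot G → ℝ)) ''
          (s.image (Quot.mk (SameOrbit G)))) := by
    simp only [LinearMap.image_convexHull, Finset.coe_image, Set.image_image, pushqLinear_single]
  simp only [carrier, Finset.coe_image, Set.image_iUnion, himage]
  ext y
  simp [quotComplex]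

theorem pushq_permAct {V : Type*} [Fintype V] {G : Subgroup (Equiv.Perm V)}
    {g : Equiv.Perm V} (hg : g ∈ G) (x : V → ℝ) : pushq G (permAct g x) = pushq G x := by
  ext t
  refine (Fintype.sum_equiv g _ _ fun v => ?_).symm
  rw [show Quot.mk (SameOrbit G) (g v) = Quot.mk (SameOrbit G) v from
    (Quot.sound ⟨g, hg, rfl⟩).symm]
  simp [permAct]

theorem pushq_apply_of_injOn {V : Type*} [Fintype V] {G : Subgroup (Equiv.Perm V)}
    {s : Finset V} (hs : Set.InjOn (Quot.mk (SameOrbit G)) s) {x : V → ℝ}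
    (hx : ∀ v, v ∉ s → x v = 0) {v : V} (hv : v ∈ s) :
    pushq G x (Quot.mk (SameOrbit G) v) = x v := by
  rw [pushq, Finset.sum_eq_single v]
  · simp
  · intro w _ hw
    by_cases hws : w ∈ s
    · rw [if_neg fun h => hw (hs hws hv h)]
    · simp [hx w hws]
  · simp

theorem exists_mem_support_of_pushq_ne_zero {V : Type*} [Fintype V]
    {G : Subgroup (Equiv.Perm V)} {x : V → ℝ} {t : OrbitQuot G} (h : pushq G x t ≠ 0) :
    ∃ v, x v ≠ 0 ∧ Quot.mk (SameOrbit G) v = t := by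
  obtain ⟨v, -, hv⟩ := Finset.exists_ne_zero_of_sum_ne_zero h
  rw [ne_eq, ite_eq_right_iff, not_forall] at hv
  exact ⟨v, hv.2, hv.1⟩

theorem quot_mk_injOn_of_mem {V : Type*} [DecidableEq V] {G : Subgroup (Equiv.Perm V)}
    {X : Set (Finset V)} (hdown : ∀ s ∈ X, ∀ t ⊆ s, t ∈ X)
    (hadj : ∀ u v : V, u ≠ v → SameOrbit G u v → ({u, v} : Finset V) ∉ X)
    {s : Finset V} (hs : s ∈ X) : Set.InjOn (Quot.mk (SameOrbit G)) s := by
  intro u hu v hv huv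
  by_contra hne
  refine hadj u v hne (quot_mk_eq_iff_sameOrbit.1 huv) (hdown s hs _ ?_)
  simpa [Finset.insert_subset_iff] using ⟨hu, hv⟩

/-- Under a pure action, an orbit-preserving map between two faces is induced by a group
element. -/
theorem IsPureAction.exists_forall_apply_eq {V : Type*} [DecidableEq V]
    {G : Subgroup (Equiv.Perm V)} {X : Set (Finset V)} (hpure : IsPureAction G X)
    (hdown : ∀ s ∈ X, ∀ t ⊆ s, t ∈ X) (hinv : ∀ g ∈ G, ∀ s ∈ X, s.image g ∈ X)
    {t : Finset V} (ht : t ∈ X) {f : V → V} (s : Finset V) (hs : s ∈ X)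
    (hft : ∀ v ∈ s, f v ∈ t) (hf : ∀ v ∈ s, SameOrbit G v (f v)) :
    ∃ g ∈ G, ∀ v ∈ s, g v = f v := by
  induction s using Finset.induction_on with
  | empty => exact ⟨1, G.one_mem, by simp⟩
  | insert u β hu ih =>
    simp only [Finset.forall_mem_insert] at hft hf
    obtain ⟨g, hg, hgf⟩ := ih (hdown _ hs _ (Finset.subset_insert u β)) hft.2 hf.2
    have hgβ : β.image g ⊆ t := Finset.image_subset_iff.2 fun v hv => hgf v hv ▸ hft.2 v hv
    have hgu : g u ∉ β.image g := by simpa using hu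
    have hfu : f u ∉ β.image g := by
      intro h
      obtain ⟨v, hv, hvu⟩ := Finset.mem_image.1 h
      refine hu ?_
      have : SameOrbit G u v := (sameOrbit_equivalence G).trans hf.1
        ((sameOrbit_equivalence G).symm ⟨g, hg, hvu⟩)
      have huv := quot_mk_injOn_of_mem hdown hpure.1 hs (Finset.mem_insert_self u β)
        (Finset.mem_insert_of_mem hv) (Quot.sound this)
      exact huv ▸ hv
    obtain ⟨k, hk, hkα, hku⟩ := hpure.2 (β.image g) (hdown t ht _ hgβ) (g u) (f u)
      ((sameOrbit_equivalence G).trans ((sameOrbit_equivalence G).symm ⟨g, hg, rfl⟩) hf.1)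
      hgu (by simpa [Finset.image_insert] using hinv g hg _ hs) hfu
      (hdown t ht _ (Finset.insert_subset hft.1 hgβ))
    refine ⟨k * g, G.mul_mem hk hg, fun v hv => ?_⟩
    rcases Finset.mem_insert.1 hv with rfl | hv
    · exact hku
    · rw [← hgf v hv]
      have hmem : g v ∈ β.image g := Finset.mem_image_of_mem g hv
      refine quot_mk_injOn_of_mem hdown hpure.1 ht (hgβ ?_) (hgβ hmem)
        (Quot.sound ⟨k, hk, rfl⟩).symm
      exact hkα ▸ Finset.mem_image_of_mem k hmem

theorem IsPureAction.exists_permAct_eq {V : Type*} [Fintype V] [DecidableEq V]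
    {G : Subgroup (Equiv.Perm V)} {X : Set (Finset V)} (hpure : IsPureAction G X)
    (hdown : ∀ s ∈ X, ∀ t ⊆ s, t ∈ X) (hinv : ∀ g ∈ G, ∀ s ∈ X, s.image g ∈ X)
    {x y : V → ℝ} (hx : x ∈ carrier X) (hy : y ∈ carrier X) (hxy : pushq G x = pushq G y) :
    ∃ g ∈ G, permAct g x = y := by
  obtain ⟨s, hs, -, hxs⟩ := exists_face_eq_support hdown hx
  obtain ⟨t, ht, -, hyt⟩ := exists_face_eq_support hdown hy
  have hsinj := quot_mk_injOn_of_mem hdown hpure.1 hs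
  have htinj := quot_mk_injOn_of_mem hdown hpure.1 ht
  have hpx {v : V} (hv : v ∈ s) : pushq G x (Quot.mk (SameOrbit G) v) = x v :=
    pushq_apply_of_injOn hsinj (fun w hw => not_not.1 ((hxs w).not.1 hw)) hv
  have hpy {v : V} (hv : v ∈ t) : pushq G y (Quot.mk (SameOrbit G) v) = y v :=
    pushq_apply_of_injOn htinj (fun w hw => not_not.1 ((hyt w).not.1 hw)) hv
  have hex : ∀ v ∈ s, ∃ w, w ∈ t ∧ SameOrbit G v w := by
    intro v hv
    obtain ⟨w, hw, hwv⟩ := exists_mem_support_of_pushq_ne_zero (G := G) (x := y)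
      (t := Quot.mk _ v) (by rw [← hxy, hpx hv]; exact (hxs v).1 hv)
    exact ⟨w, (hyt w).2 hw, quot_mk_eq_iff_sameOrbit.1 hwv.symm⟩
  choose! f hft hf using hex
  obtain ⟨g, hg, hgf⟩ := hpure.exists_forall_apply_eq hdown hinv ht s hs hft hf
  have hval {v : V} (hv : v ∈ s) : x v = y (g v) := by
    rw [← hpx hv, hxy, show Quot.mk (SameOrbit G) v = Quot.mk (SameOrbit G) (g v) from
      Quot.sound ⟨g, hg, rfl⟩, hpy (hgf v hv ▸ hft v hv)]
  refine ⟨g, hg, funext fun w => ?_⟩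
  obtain ⟨v, rfl⟩ := g.surjective w
  simp only [permAct, Function.comp_apply, Equiv.symm_apply_apply]
  by_cases hv : v ∈ s
  · exact hval hv
  · rw [not_not.1 ((hxs v).not.1 hv)]
    by_contra hne
    have hgv : g v ∈ t := (hyt _).2 (Ne.symm hne)
    obtain ⟨u, hu, huv⟩ := exists_mem_support_of_pushq_ne_zero (G := G) (x := x)
      (t := Quot.mk _ (g v)) (by rw [hxy, hpy hgv]; exact Ne.symm hne)
    have hus : u ∈ s := (hxs u).2 hu
    have hgu : g u ∈ t := hgf u hus ▸ hft u hus
    have : g u = g v := htinj hgu hgv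
      ((Quot.sound ⟨g, hg, rfl⟩ : Quot.mk (SameOrbit G) u = _).symm.trans huv)
    exact hv (g.injective this ▸ hus)

/-- The barycenter of a finite set of vertices. -/
noncomputable def barycenter {V : Type*} [DecidableEq V] (s : Finset V) : V → ℝ :=
  (s.card : ℝ)⁻¹ • ∑ v ∈ s, Pi.single v 1

theorem barycenter_apply {V : Type*} [DecidableEq V] (s : Finset V) (v : V) :
    barycenter s v = if v ∈ s then (s.card : ℝ)⁻¹ else 0 := by
  simp [barycenter, Finset.sum_apply, Pi.single_apply]

theorem barycenter_apply_ne_zero {V : Type*} [DecidableEq V] {s : Finset V} {v : V} :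
    barycenter s v ≠ 0 ↔ v ∈ s := by
  rw [barycenter_apply]
  split_ifs with h
  · simpa [h] using Finset.ne_empty_of_mem h
  · simpa using h

theorem barycenter_mem_carrier {V : Type*} [DecidableEq V] {X : Set (Finset V)} {s : Finset V}
    (hs : s ∈ X) (hne : s.Nonempty) : barycenter s ∈ carrier X := by
  refine mem_carrier_iff.2 ⟨s, hs, fun v => ?_, fun v hv => ?_, ?_⟩
  · rw [barycenter_apply]
    split_ifs <;> positivity
  · rw [barycenter_apply, if_neg hv]
  · have : (s.card : ℝ) ≠ 0 := by exact_mod_cast hne.card_ne_zero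
    rw [Finset.sum_congr rfl fun v hv => by rw [barycenter_apply, if_pos hv]]
    simp [this]

theorem pushq_barycenter {V : Type*} [Fintype V] [DecidableEq V] (G : Subgroup (Equiv.Perm V))
    (s : Finset V) : pushq G (barycenter s) =
      (s.card : ℝ)⁻¹ • ∑ v ∈ s, Pi.single (Quot.mk (SameOrbit G) v) 1 := by
  rw [← pushqLinear_apply, barycenter, map_smul, map_sum]
  simp only [pushqLinear_single]

theorem image_eq_of_permAct_barycenter {V : Type*} [DecidableEq V] {s t : Finset V}
    {g : Equiv.Perm V} (h : permAct g (barycenter s) = barycenter t) : s.image g = t := by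
  ext w
  rw [← barycenter_apply_ne_zero (s := t), ← h, permAct, Function.comp_apply,
    barycenter_apply_ne_zero, Finset.mem_image]
  constructor
  · rintro ⟨v, hv, rfl⟩
    simpa using hv
  · exact fun hw => ⟨_, hw, g.apply_symm_apply w⟩

theorem isPureAction_of_forall_exists_permAct {V : Type*} [Fintype V] [DecidableEq V]
    {G : Subgroup (Equiv.Perm V)} {X : Set (Finset V)} (hdown : ∀ s ∈ X, ∀ t ⊆ s, t ∈ X)
    (H : ∀ x ∈ carrier X, ∀ y ∈ carrier X, pushq G x = pushq G y → ∃ g ∈ G, permAct g x = y) :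
    IsPureAction G X := by
  have hadj : ∀ u v : V, u ≠ v → SameOrbit G u v → ({u, v} : Finset V) ∉ X := by
    intro u v huv ho hX
    have hu : ({u} : Finset V) ∈ X := hdown _ hX _ (by simp)
    obtain ⟨g, -, hg⟩ := H _ (barycenter_mem_carrier hu (by simp))
      _ (barycenter_mem_carrier hX (by simp)) (by
        rw [pushq_barycenter, pushq_barycenter, Finset.sum_pair huv, Finset.card_pair huv,
          ← Quot.sound ho, ← two_smul ℝ, smul_smul]
        simp)
    have := congrArg Finset.card (image_eq_of_permAct_barycenter hg)
    rw [Finset.card_image_of_injective _ g.injective, Finset.card_pair huv] at this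
    simp at this
  refine ⟨hadj, fun α _ u v ho hu huX hv hvX => ?_⟩
  obtain ⟨g, hgG, hg⟩ := H _ (barycenter_mem_carrier huX (by simp))
    _ (barycenter_mem_carrier hvX (by simp)) (by
      rw [pushq_barycenter, pushq_barycenter, Finset.sum_insert hu, Finset.sum_insert hv,
        Finset.card_insert_of_notMem hu, Finset.card_insert_of_notMem hv, Quot.sound ho])
  have himg := image_eq_of_permAct_barycenter hg
  have hgu : g u = v := by
    refine quot_mk_injOn_of_mem hdown hadj hvX ?_ (Finset.mem_insert_self v α) (Quot.sound
      ((sameOrbit_equivalence G).trans ((sameOrbit_equivalence G).symm ⟨g, hgG, rfl⟩) ho))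
    exact himg ▸ Finset.mem_image_of_mem g (Finset.mem_insert_self u α)
  refine ⟨g, hgG, ?_, hgu⟩
  have hvg : v ∉ α.image g := by
    rw [← hgu]
    simpa using hu
  rw [Finset.image_insert, hgu] at himg
  rw [← Finset.erase_insert hvg, himg, Finset.erase_insert hv]

/-- Let `G` be a group of simplicial automorphisms of a finite simplicial complex `X`, acting
piecewise linearly on the geometric carrier `|X|`.  The map `|X|/G → |X/G|` induced by the
quotient simplicial map is a homeomorphism if and only if the action of `G` on `X` is pure. -/
theorem pure_iff_quotient_homeomorph {V : Type*} [Fintype V] [DecidableEq V]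
    (G : Subgroup (Equiv.Perm V)) (X : Set (Finset V))
    (hdown : ∀ s ∈ X, ∀ t ⊆ s, t ∈ X)
    (hinv : ∀ g ∈ G, ∀ s ∈ X, s.image g ∈ X) :
    IsPureAction G X ↔
      ∃ h : Quot (carrierRel G X) ≃ₜ {y : OrbitQuot G → ℝ // y ∈ carrier (quotComplex G X)},
        ∀ x : {x : V → ℝ // x ∈ carrier X},
          ((h (Quot.mk (carrierRel G X) x) : {y : OrbitQuot G → ℝ // y ∈ carrier (quotComplex G X)}) : OrbitQuot G → ℝ)
            = pushq G x.val := by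
  constructor
  · intro hpure
    have hmem (x : {x : V → ℝ // x ∈ carrier X}) :
        pushq G x.val ∈ carrier (quotComplex G X) :=
      image_pushq_carrier G X ▸ Set.mem_image_of_mem _ x.2
    let F : {x : V → ℝ // x ∈ carrier X} →
        {y : OrbitQuot G → ℝ // y ∈ carrier (quotComplex G X)} := fun x => ⟨pushq G x.val, hmem x⟩
    have hFrel : ∀ x y, carrierRel G X x y → F x = F y := by
      rintro x y ⟨g, hg, h⟩
      exact Subtype.ext (by simp only [F, ← h, pushq_permAct hg])
    have hFcont : Continuous F :=
      ((pushqLinear G).continuous_of_finiteDimensional.comp continuous_subtype_val).subtype_mk _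
    have hbij : Function.Bijective (Quot.lift F hFrel) := by
      constructor
      · rintro ⟨x⟩ ⟨y⟩ hxy
        exact Quot.sound (hpure.exists_permAct_eq hdown hinv x.2 y.2 (congrArg Subtype.val hxy))
      · rintro ⟨y, hy⟩
        obtain ⟨x, hx, rfl⟩ := (image_pushq_carrier G X).symm ▸ hy
        exact ⟨Quot.mk _ ⟨x, hx⟩, rfl⟩
    have : CompactSpace {x : V → ℝ // x ∈ carrier X} :=
      isCompact_iff_compactSpace.1 (isCompact_carrier X)
    refine ⟨Continuous.homeoOfEquivCompactToT2 (f := Equiv.ofBijective _ hbij)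
      (continuous_quot_lift hFrel hFcont), fun x => rfl⟩
  · rintro ⟨h, hh⟩
    refine isPureAction_of_forall_exists_permAct hdown fun x hx y hy hxy => ?_
    refine ((carrierRel_equivalence G X).quot_mk_eq_iff ⟨x, hx⟩ ⟨y, hy⟩).1 (h.injective ?_)
    exact Subtype.ext ((hh ⟨x, hx⟩).trans (hxy.trans (hh ⟨y, hy⟩).symm))
end

section
/- The unique 6-vertex simplicial subdivision of the 3-cube (as the product of the square prism structure, i.e., the polytope C³₁ = x₁x₂ × x₁x₂ × x₁x₂ with vertex set {x_ijk : i,j,k ∈ {1,2}}) respecting the given boundary triangulation S⁰(x₁₁₁,x₂₂₂) ∗ S¹₆(x₁₂₁,x₂₂₁,x₂₁₁,x₂₁₂,x₁₁₂,x₁₂₂) without adding new vertices is the join x₁₁₁x₂₂₂ ∗ S¹₆, i.e., the cone-of-cone over the hexagonal 1-sphere through the main diagonal. -/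
open scoped Classical

/-- The vertex `x_{ijk}` of the cube `[−1,1]³`, where `false` encodes subscript `1` (coordinate
`−1`) and `true` encodes subscript `2` (coordinate `1`). -/
def cubeVtx (a b c : Bool) : Fin 3 → ℝ :=
  ![if a then 1 else -1, if b then 1 else -1, if c then 1 else -1]

/-- The set of the eight vertices of the cube. -/
def cubeVtxSet : Set (Fin 3 → ℝ) :=
  Set.range fun p : Bool × Bool × Bool => cubeVtx p.1 p.2.1 p.2.2

/-- The 3-cube `C³₁ = x₁x₂ × x₁x₂ × x₁x₂`. -/
def cube : Set (Fin 3 → ℝ) := convexHull ℝ cubeVtxSet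

/-- The hexagonal cycle `S¹₆` of boundary vertices
`x₁₂₁, x₂₂₁, x₂₁₁, x₂₁₂, x₁₁₂, x₁₂₂`. -/
def hex : Fin 6 → (Fin 3 → ℝ) :=
  ![cubeVtx false true false, cubeVtx true true false, cubeVtx true false false,
    cubeVtx true false true, cubeVtx false false true, cubeVtx false true true]

/-- The faces of the join `x₁₁₁x₂₂₂ ∗ S¹₆`: all nonempty subsets of the tetrahedra
`{x₁₁₁, x₂₂₂, h_i, h_{i+1}}` along the hexagon. -/
def joinFaces : Set (Finset (Fin 3 → ℝ)) :=
  {s | s.Nonempty ∧ ∃ i : Fin 6,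
    s ⊆ {cubeVtx false false false, cubeVtx true true true, hex i, hex (i + 1)}}

/-- A simplicial subdivision of the cube with no new vertices, restricting on the boundary to
the triangulation `S⁰(x₁₁₁, x₂₂₂) ∗ S¹₆` (i.e. containing all its boundary triangles). -/
def IsDiagonalSubdivision (K : Geometry.SimplicialComplex ℝ (Fin 3 → ℝ)) : Prop :=
  K.space = cube ∧
  (∀ s ∈ K.faces, (s : Set (Fin 3 → ℝ)) ⊆ cubeVtxSet) ∧
  (∀ i : Fin 6,
    ({cubeVtx false false false, hex i, hex (i + 1)} : Finset (Fin 3 → ℝ)) ∈ K.faces ∧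
    ({cubeVtx true true true, hex i, hex (i + 1)} : Finset (Fin 3 → ℝ)) ∈ K.faces)

theorem mem_cubeVtxSet_iff {v : Fin 3 → ℝ} :
    v ∈ cubeVtxSet ↔ ∀ j, v j = 1 ∨ v j = -1 := by
  constructor
  · rintro ⟨⟨a, b, c⟩, rfl⟩ j
    fin_cases j <;> simp [cubeVtx] <;> grind
  · intro h
    refine ⟨⟨decide (v 0 = 1), decide (v 1 = 1), decide (v 2 = 1)⟩, ?_⟩
    funext j
    have := h j
    fin_cases j <;> simp [cubeVtx] at this ⊢ <;> grind

/-- The maximal simplices `{x₁₁₁, x₂₂₂, h_i, h_{i+1}}` of the join. -/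
noncomputable def joinSimplex (i : Fin 6) : Finset (Fin 3 → ℝ) :=
  {cubeVtx false false false, cubeVtx true true true, hex i, hex (i + 1)}

/-- The coordinate that is smallest on the `i`-th maximal simplex. -/
def loCoord : Fin 6 → Fin 3 := ![2, 2, 1, 1, 0, 0]

/-- The coordinate that is in the middle on the `i`-th maximal simplex. -/
def midCoord : Fin 6 → Fin 3 := ![0, 1, 2, 0, 1, 2]

/-- The coordinate that is largest on the `i`-th maximal simplex. -/
def hiCoord : Fin 6 → Fin 3 := ![1, 0, 0, 2, 2, 1]

theorem coord_cases : ∀ (i : Fin 6) (j : Fin 3), j = loCoord i ∨ j = midCoord i ∨ j = hiCoord i := by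
  decide

theorem coord_ne : ∀ i : Fin 6,
    loCoord i ≠ midCoord i ∧ loCoord i ≠ hiCoord i ∧ midCoord i ≠ hiCoord i := by
  decide

theorem mem_joinSimplex_iff {i : Fin 6} {v : Fin 3 → ℝ} :
    v ∈ joinSimplex i ↔
      v ∈ cubeVtxSet ∧ v (loCoord i) ≤ v (midCoord i) ∧ v (midCoord i) ≤ v (hiCoord i) := by
  constructor
  · intro h
    simp only [joinSimplex, Finset.mem_insert, Finset.mem_singleton] at h
    refine ⟨?_, ?_⟩
    · fin_cases i <;> rcases h with rfl | rfl | rfl | rfl <;>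
        exact ⟨⟨_, _, _⟩, rfl⟩
    · fin_cases i <;> rcases h with rfl | rfl | rfl | rfl <;>
        simp [hex, cubeVtx, loCoord, midCoord, hiCoord]
  · rintro ⟨⟨⟨a, b, c⟩, rfl⟩, h⟩
    simp only [joinSimplex, Finset.mem_insert, Finset.mem_singleton]
    fin_cases i <;> cases a <;> cases b <;> cases c <;>
      solve
      | simp [hex]
      | (exfalso; simp [cubeVtx, loCoord, midCoord, hiCoord] at h; norm_num at h)

theorem exists_sorted (x : Fin 3 → ℝ) :
    ∃ i, x (loCoord i) ≤ x (midCoord i) ∧ x (midCoord i) ≤ x (hiCoord i) := by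
  rcases le_total (x 0) (x 1) with h | h <;> rcases le_total (x 1) (x 2) with h' | h' <;>
    rcases le_total (x 0) (x 2) with h'' | h'' <;>
    first
    | exact ⟨0, by assumption, by assumption⟩
    | exact ⟨1, by assumption, by assumption⟩
    | exact ⟨2, by assumption, by assumption⟩
    | exact ⟨3, by assumption, by assumption⟩
    | exact ⟨4, by assumption, by assumption⟩
    | exact ⟨5, by assumption, by assumption⟩

/-- `u` is a vertex of the simplex of the join whose relative interior contains `x`. -/
def Separates (u x : Fin 3 → ℝ) : Prop :=
  (∀ i j, u i < u j → x i < x j) ∧ (∀ i, u i = 1 → -1 < x i) ∧ ∀ i, u i = -1 → x i < 1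

theorem mem_joinSimplex_of_lt_imp_lt {i : Fin 6} {u x : Fin 3 → ℝ} (hu : u ∈ cubeVtxSet)
    (hux : ∀ a b, u a < u b → x a < x b) (h₁ : x (loCoord i) ≤ x (midCoord i))
    (h₂ : x (midCoord i) ≤ x (hiCoord i)) : u ∈ joinSimplex i :=
  mem_joinSimplex_iff.2 ⟨hu, le_of_not_gt fun h => (hux _ _ h).not_ge h₁,
    le_of_not_gt fun h => (hux _ _ h).not_ge h₂⟩

theorem isChain_joinSimplex (i : Fin 6) :
    IsChain (· ≤ ·) (joinSimplex i : Set (Fin 3 → ℝ)) := by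
  intro u hu v hv _
  obtain ⟨hu, hu₁, hu₂⟩ := mem_joinSimplex_iff.1 hu
  obtain ⟨hv, hv₁, hv₂⟩ := mem_joinSimplex_iff.1 hv
  rw [mem_cubeVtxSet_iff] at hu hv
  have := hu (loCoord i)
  have := hu (midCoord i)
  have := hu (hiCoord i)
  have := hv (loCoord i)
  have := hv (midCoord i)
  have := hv (hiCoord i)
  have key : (∀ j, u j ≤ v j) ∨ ∀ j, v j ≤ u j := by
    by_contra! hcon
    obtain ⟨⟨j, hj⟩, k, hk⟩ := hcon
    rcases coord_cases i j with rfl | rfl | rfl <;> rcases coord_cases i k with rfl | rfl | rfl <;>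
      grind
  exact key

theorem exists_subset_joinSimplex {s : Finset (Fin 3 → ℝ)}
    (hs : (s : Set (Fin 3 → ℝ)) ⊆ cubeVtxSet)
    (hc : IsChain (· ≤ ·) (s : Set (Fin 3 → ℝ))) : ∃ i, s ⊆ joinSimplex i := by
  obtain ⟨i, h₁, h₂⟩ := exists_sorted (∑ v ∈ s, v)
  refine ⟨i, fun u hu => mem_joinSimplex_of_lt_imp_lt (hs hu) (fun a b hab => ?_) h₁ h₂⟩
  rw [Finset.sum_apply, Finset.sum_apply]
  refine Finset.sum_lt_sum (fun v hv => ?_) ⟨u, hu, hab⟩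
  by_contra! hlt
  have hu' := mem_cubeVtxSet_iff.1 (hs hu)
  have hv' := mem_cubeVtxSet_iff.1 (hs hv)
  have := hu' a
  have := hu' b
  have := hv' a
  have := hv' b
  rcases hc.total hu hv with h | h
  · have := h b
    grind
  · have := h a
    grind

theorem exists_inf_sup_subset_joinSimplex {u v : Fin 3 → ℝ} (hu : u ∈ cubeVtxSet)
    (hv : v ∈ cubeVtxSet) : ∃ i, {u ⊓ v, u ⊔ v} ⊆ joinSimplex i := by
  refine exists_subset_joinSimplex ?_ ?_
  · intro w hw
    rw [mem_cubeVtxSet_iff] at *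
    intro j
    have := hu j
    have := hv j
    rw [Finset.coe_pair] at hw
    rcases hw with rfl | rfl
    · rw [Pi.inf_apply]
      grind
    · rw [Pi.sup_apply]
      grind
  · rw [Finset.coe_pair]
    exact IsChain.pair inf_le_sup

theorem mem_convexHull_of_separates {s : Set (Fin 3 → ℝ)} {x : Fin 3 → ℝ}
    (hx : ∀ j, -1 ≤ x j ∧ x j ≤ 1) (h : ∀ u ∈ cubeVtxSet, Separates u x → u ∈ s) :
    x ∈ convexHull ℝ s := by
  obtain ⟨i, h₁, h₂⟩ := exists_sorted x
  have hcoord := coord_cases i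
  generalize loCoord i = l, midCoord i = m, hiCoord i = k at h₁ h₂ hcoord
  let w : Fin 4 → ℝ := ![(1 - x k) / 2, (x k - x m) / 2, (x m - x l) / 2, (x l + 1) / 2]
  let z : Fin 4 → Fin 3 → ℝ := ![fun _ => -1, fun j => if x k ≤ x j then 1 else -1,
    fun j => if x m ≤ x j then 1 else -1, fun _ => 1]
  have hwz : ∑ t, w t • z t = x := by
    funext j
    simp only [Fin.sum_univ_four, w, z]
    rcases hcoord j with rfl | rfl | rfl <;> simp <;> grind
  have hw : ∑ t, w t = 1 := by
    simp only [Fin.sum_univ_four, w]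
    simp
    ring
  have hw₀ : ∀ t, 0 ≤ w t := by
    have := hx k
    have := hx l
    intro t
    fin_cases t <;> simp [w] <;> linarith
  have hmem : ∀ t, w t ≠ 0 → z t ∈ s := by
    intro t ht
    have ht := lt_of_le_of_ne (hw₀ t) ht.symm
    have := hx k
    have := hx m
    have := hx l
    refine h _ (mem_cubeVtxSet_iff.2 fun j => ?_) ⟨fun a b hab => ?_, fun a ha => ?_, fun a ha => ?_⟩
    · fin_cases t <;> simp [z] <;> grind
    · fin_cases t <;> simp [z, w] at hab ht ⊢ <;> grind
    · have := hcoord a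
      fin_cases t <;> simp [z, w] at ha ht ⊢ <;> grind
    · have := hcoord a
      fin_cases t <;> simp [z, w] at ha ht ⊢ <;> grind
  rw [← hwz, ← Finset.sum_filter_of_ne (p := fun t => w t ≠ 0) (fun t _ ht hw => ht (by simp [hw]))]
  refine (convex_convexHull ℝ s).sum_mem (fun t _ => hw₀ t) ?_ fun t ht =>
    subset_convexHull ℝ s (hmem t (Finset.mem_filter.1 ht).2)
  rw [Finset.sum_filter_ne_zero, hw]

theorem apply_eq_of_mem_convexHull {s : Set (Fin 3 → ℝ)} {x : Fin 3 → ℝ} {a b : Fin 3}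
    (hx : x ∈ convexHull ℝ s) (h : ∀ v ∈ s, v a = v b) : x a = x b := by
  refine convexHull_min (t := {y : Fin 3 → ℝ | y a = y b}) h ?_ hx
  intro y hy z hz p q _ _ _
  simp only [Set.mem_ofPred_eq, Pi.add_apply, Pi.smul_apply] at *
  rw [hy, hz]

theorem apply_le_of_mem_convexHull {s : Set (Fin 3 → ℝ)} {x : Fin 3 → ℝ} {a b : Fin 3}
    (hx : x ∈ convexHull ℝ s) (h : ∀ v ∈ s, v a ≤ v b) : x a ≤ x b := by
  refine convexHull_min (t := {y : Fin 3 → ℝ | y a ≤ y b}) h ?_ hx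
  intro y hy z hz p q hp hq _
  simp only [Set.mem_ofPred_eq, Pi.add_apply, Pi.smul_apply, smul_eq_mul] at *
  gcongr

theorem apply_mem_of_mem_convexHull {s : Set (Fin 3 → ℝ)} {x : Fin 3 → ℝ} {a : Fin 3} {t : Set ℝ}
    (ht : Convex ℝ t) (hx : x ∈ convexHull ℝ s) (h : ∀ v ∈ s, v a ∈ t) : x a ∈ t :=
  convexHull_min (t := (LinearMap.proj a : (Fin 3 → ℝ) →ₗ[ℝ] ℝ) ⁻¹' t) h
    (ht.linear_preimage _) hx

theorem mem_cube_iff {x : Fin 3 → ℝ} : x ∈ cube ↔ ∀ j, -1 ≤ x j ∧ x j ≤ 1 := by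
  refine ⟨fun hx j => ?_, fun hx => mem_convexHull_of_separates hx fun u hu _ => hu⟩
  refine apply_mem_of_mem_convexHull (convex_Icc (-1) 1) hx fun v hv => ?_
  rcases mem_cubeVtxSet_iff.1 hv j with h | h <;> rw [h] <;> norm_num

theorem Separates.mem {i : Fin 6} {s : Finset (Fin 3 → ℝ)} {u x : Fin 3 → ℝ}
    (hux : Separates u x) (hu : u ∈ cubeVtxSet) (hs : s ⊆ joinSimplex i)
    (hx : x ∈ convexHull ℝ (s : Set (Fin 3 → ℝ))) : u ∈ s := by
  have hs' := fun v (hv : v ∈ s) => mem_joinSimplex_iff.1 (hs hv)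
  have hui := mem_joinSimplex_of_lt_imp_lt (i := i) hu hux.1
    (apply_le_of_mem_convexHull hx fun v hv => (hs' v hv).2.1)
    (apply_le_of_mem_convexHull hx fun v hv => (hs' v hv).2.2)
  obtain ⟨-, hu₁, hu₂⟩ := mem_joinSimplex_iff.1 hui
  rw [mem_cubeVtxSet_iff] at hu
  have hcoord := coord_cases i
  generalize loCoord i = l, midCoord i = m, hiCoord i = k at hu₁ hu₂ hcoord hs'
  by_contra hus
  have hne : ∀ v ∈ s, ¬ (v l = u l ∧ v m = u m ∧ v k = u k) := by
    rintro v hv ⟨h₁, h₂, h₃⟩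
    have : v = u := by
      funext j
      rcases hcoord j with rfl | rfl | rfl <;> assumption
    exact hus (this ▸ hv)
  have hs'' : ∀ v ∈ s, (v l = 1 ∨ v l = -1) ∧ (v m = 1 ∨ v m = -1) ∧ (v k = 1 ∨ v k = -1) ∧
      v l ≤ v m ∧ v m ≤ v k := fun v hv =>
    have h := mem_cubeVtxSet_iff.1 (hs' v hv).1
    ⟨h l, h m, h k, (hs' v hv).2⟩
  obtain ⟨hux₁, hux₂, hux₃⟩ := hux
  have hul := hu l
  have hum := hu m
  have huk := hu k
  rcases huk with huk | huk
  · rcases hum with hum | hum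
    · rcases hul with hul | hul
      · have h := apply_mem_of_mem_convexHull (convex_singleton (-1 : ℝ)) hx (a := l)
          fun v hv => by have := hs'' v hv; have := hne v hv; simp; grind
        have := hux₂ l hul
        simp at h
        linarith
      · have h := apply_eq_of_mem_convexHull hx (a := l) (b := m)
          fun v hv => by have := hs'' v hv; have := hne v hv; grind
        have := hux₁ l m (by linarith)
        linarith
    · have h := apply_eq_of_mem_convexHull hx (a := m) (b := k)
        fun v hv => by have := hs'' v hv; have := hne v hv; grind
      have := hux₁ m k (by linarith)
      linarith
  · have h := apply_mem_of_mem_convexHull (convex_singleton (1 : ℝ)) hx (a := k)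
      fun v hv => by have := hs'' v hv; have := hne v hv; simp; grind
    have := hux₃ k huk
    simp at h
    linarith

theorem affineIndependent_joinSimplex (i : Fin 6) :
    AffineIndependent ℝ fun v : (joinSimplex i : Set (Fin 3 → ℝ)) => (v : Fin 3 → ℝ) := by
  let p : Fin 4 → Fin 3 → ℝ :=
    ![cubeVtx false false false, cubeVtx true true true, hex i, hex (i + 1)]
  have hp : AffineIndependent ℝ p := by
    rw [affineIndependent_iff_of_fintype]
    intro w hw hwp
    rw [Finset.weightedVSub_eq_linear_combination _ hw] at hwp
    have h₀ := congrFun hwp 0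
    have h₁ := congrFun hwp 1
    have h₂ := congrFun hwp 2
    simp only [Fin.sum_univ_four, p] at hw h₀ h₁ h₂
    intro t
    fin_cases i <;> simp [cubeVtx, hex] at h₀ h₁ h₂ <;> fin_cases t <;> simp <;> linarith
  have hr : Set.range p = (joinSimplex i : Set (Fin 3 → ℝ)) := by
    ext v
    simp [p, joinSimplex]
    tauto
  exact hr ▸ hp.range

/-- The join `x₁₁₁x₂₂₂ ∗ S¹₆` as a geometric simplicial complex. -/
def joinComplex : Geometry.SimplicialComplex ℝ (Fin 3 → ℝ) where
  faces := joinFaces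
  isRelLowerSet_faces := by
    rintro s ⟨hs, i, hi⟩
    exact ⟨hs, fun t hts ht => ⟨ht, i, hts.trans hi⟩⟩
  indep := by
    rintro s ⟨-, i, hi⟩
    exact (affineIndependent_joinSimplex i).mono (Finset.coe_subset.2 hi)
  inter_subset_convexHull := by
    rintro s t ⟨-, i, hi⟩ ⟨-, j, hj⟩ x ⟨hxs, hxt⟩
    refine mem_convexHull_of_separates (mem_cube_iff.1 ?_) fun u hu hux =>
      ⟨hux.mem hu hi hxs, hux.mem hu hj hxt⟩
    exact convexHull_mono (fun v hv => (mem_joinSimplex_iff.1 (hi hv)).1) hxs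

theorem isDiagonalSubdivision_joinComplex : IsDiagonalSubdivision joinComplex := by
  have hV : ∀ s ∈ joinComplex.faces, (s : Set (Fin 3 → ℝ)) ⊆ cubeVtxSet := by
    rintro s ⟨-, i, hi⟩ v hv
    exact (mem_joinSimplex_iff.1 (hi hv)).1
  refine ⟨?_, hV, fun i => ⟨⟨by simp, i, ?_⟩, ⟨by simp, i, ?_⟩⟩⟩
  · ext x
    rw [Geometry.SimplicialComplex.mem_space_iff]
    refine ⟨fun ⟨s, hs, hx⟩ => convexHull_mono (hV s hs) hx, fun hx => ?_⟩
    obtain ⟨i, h₁, h₂⟩ := exists_sorted x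
    refine ⟨joinSimplex i, ⟨by simp [joinSimplex], i, subset_rfl⟩, ?_⟩
    exact mem_convexHull_of_separates (mem_cube_iff.1 hx) fun u hu hux =>
      mem_joinSimplex_of_lt_imp_lt hu hux.1 h₁ h₂
  · grind
  · grind

theorem exists_third_coord : ∀ a b : Fin 3, a ≠ b → ∃ c, c ≠ a ∧ c ≠ b := by
  decide

theorem cubeVtx_false : cubeVtx false false false = fun _ => -1 := by
  funext j
  fin_cases j <;> rfl

theorem cubeVtx_true : cubeVtx true true true = fun _ => 1 := by
  funext j
  fin_cases j <;> rfl

namespace IsDiagonalSubdivision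

variable {K : Geometry.SimplicialComplex ℝ (Fin 3 → ℝ)} {s : Finset (Fin 3 → ℝ)}
  {u v : Fin 3 → ℝ}

theorem mem_faces_of_subset (hK : IsDiagonalSubdivision K) (hs : s.Nonempty) {i : Fin 6}
    (hi : s ⊆ joinSimplex i)
    (h : cubeVtx false false false ∉ s ∨ cubeVtx true true true ∉ s) : s ∈ K.faces := by
  rcases h with h | h
  · refine K.down_closed (hK.2.2 i).2 (fun v hv => ?_) hs
    have := hi hv
    simp only [joinSimplex] at this
    grind
  · refine K.down_closed (hK.2.2 i).1 (fun v hv => ?_) hs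
    have := hi hv
    simp only [joinSimplex] at this
    grind

theorem inf_sup_notMem_faces (hs : s ∈ K.faces) (hu : u ∈ s) (hv : v ∈ s) {a b : Fin 3}
    (ha : u a < v a) (hb : v b < u b) :
    ({u ⊓ v, u ⊔ v} : Finset (Fin 3 → ℝ)) ∉ K.faces := by
  intro h
  have hmid : midpoint ℝ (u ⊓ v) (u ⊔ v) = midpoint ℝ u v := by
    rw [midpoint_eq_smul_add, midpoint_eq_smul_add, inf_add_sup]
  have huv : ({u, v} : Finset (Fin 3 → ℝ)) ∈ K.faces :=
    K.down_closed hs (by grind) (by simp)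
  have hx := K.inter_subset_convexHull huv h (a := midpoint ℝ u v) ⟨?_, ?_⟩
  · have hempty : (({u, v} : Finset (Fin 3 → ℝ)) ∩ ({u ⊓ v, u ⊔ v} : Finset (Fin 3 → ℝ)) :
        Set (Fin 3 → ℝ)) = ∅ := by
      ext w
      simp only [Finset.coe_insert, Finset.coe_singleton, Set.mem_inter_iff, Set.mem_insert_iff,
        Set.mem_singleton_iff, Set.mem_empty_iff_false, iff_false]
      rintro ⟨rfl | rfl, h | h⟩
      all_goals
        have h₁ := congrFun h a
        have h₂ := congrFun h b
        simp only [Pi.inf_apply, Pi.sup_apply] at h₁ h₂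
        grind
    rw [hempty, convexHull_empty] at hx
    exact hx
  · rw [Finset.coe_pair, convexHull_pair]
    exact midpoint_mem_segment _ _
  · rw [Finset.coe_pair, convexHull_pair, ← hmid]
    exact midpoint_mem_segment _ _

theorem not_lt_of_apply_eq (hK : IsDiagonalSubdivision K) (hs : s ∈ K.faces) (hu : u ∈ s)
    (hv : v ∈ s) {a b c : Fin 3} (ha : u a < v a) (hc : u c = v c) : ¬ v b < u b := by
  intro hb
  refine inf_sup_notMem_faces hs hu hv ha hb ?_
  have hu' := mem_cubeVtxSet_iff.1 (hK.2.1 s hs hu)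
  have hv' := mem_cubeVtxSet_iff.1 (hK.2.1 s hs hv)
  obtain ⟨i, hi⟩ := exists_inf_sup_subset_joinSimplex (hK.2.1 s hs hu) (hK.2.1 s hs hv)
  refine hK.mem_faces_of_subset (by simp) hi ?_
  have := hu' a
  have := hv' a
  have := hu' b
  have := hv' b
  simp only [Finset.mem_insert, Finset.mem_singleton, not_or, cubeVtx_false, cubeVtx_true,
    funext_iff, Pi.inf_apply, Pi.sup_apply]
  rcases hu' c with h | h
  · left
    exact ⟨fun H => by have := H c; grind, fun H => by have := H a; grind⟩
  · right
    exact ⟨fun H => by have := H a; grind, fun H => by have := H c; grind⟩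

theorem apply_eq_of_antipodal (hK : IsDiagonalSubdivision K) (hs : s ∈ K.faces) (hu : u ∈ s)
    (hv : v ∈ s) {a b c : Fin 3} (ha : u a < v a) (hb : v b < u b) (hc : u c ≠ v c)
    (hac : u a = u c) {w : Fin 3 → ℝ} (hw : w ∈ s) : w a = w c := by
  have hu' := mem_cubeVtxSet_iff.1 (hK.2.1 s hs hu)
  have hv' := mem_cubeVtxSet_iff.1 (hK.2.1 s hs hv)
  have hw' := mem_cubeVtxSet_iff.1 (hK.2.1 s hs hw)
  have := hK.not_lt_of_apply_eq hs hw hv (a := a) (b := b) (c := c)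
  have := hK.not_lt_of_apply_eq hs hw hu (a := b) (b := c) (c := a)
  have := hK.not_lt_of_apply_eq hs hw hv (a := c) (b := b) (c := a)
  have := hK.not_lt_of_apply_eq hs hu hw (a := a) (b := b) (c := c)
  have := hu' a
  have := hu' b
  have := hu' c
  have := hv' a
  have := hv' b
  have := hv' c
  have := hw' a
  have := hw' b
  have := hw' c
  grind

theorem exists_apply_eq_of_not_isChain (hK : IsDiagonalSubdivision K) (hs : s ∈ K.faces)
    (hc : ¬ IsChain (· ≤ ·) (s : Set (Fin 3 → ℝ))) :
    ∃ a b, a ≠ b ∧ ∀ w ∈ s, w a = w b := by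
  simp only [IsChain, Set.Pairwise, not_forall] at hc
  obtain ⟨u, hu, v, hv, -, huv⟩ := hc
  simp only [Pi.le_def, not_or, not_forall, not_le] at huv
  obtain ⟨⟨b, hb⟩, a, ha⟩ := huv
  have hab : a ≠ b := by
    rintro rfl
    exact lt_asymm ha hb
  obtain ⟨c, hca, hcb⟩ := exists_third_coord a b hab
  have huc : u c ≠ v c := fun h => hK.not_lt_of_apply_eq hs hu hv ha h hb
  by_cases h : u a = u c
  · exact ⟨a, c, hca.symm, fun w hw => hK.apply_eq_of_antipodal hs hu hv ha hb huc h hw⟩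
  · refine ⟨b, c, hcb.symm, fun w hw =>
      hK.apply_eq_of_antipodal hs hv hu hb ha huc.symm ?_ hw⟩
    have hu' := mem_cubeVtxSet_iff.1 (hK.2.1 s hs hu)
    have hv' := mem_cubeVtxSet_iff.1 (hK.2.1 s hs hv)
    have := hu' a
    have := hu' c
    have := hv' a
    have := hv' b
    have := hv' c
    have := hu' b
    grind

theorem joinSimplex_mem_faces (hK : IsDiagonalSubdivision K) (i : Fin 6) :
    joinSimplex i ∈ K.faces := by
  let p : Fin 3 → ℝ := fun j => if j = hiCoord i then 1 / 2 else if j = loCoord i then -1 / 2 else 0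
  have hpcube : p ∈ cube := mem_cube_iff.2 fun j => by
    simp only [p]
    split_ifs <;> norm_num
  obtain ⟨hlm, hlh, hmh⟩ := coord_ne i
  have hpl : p (loCoord i) = -1 / 2 := by simp [p, hlh]
  have hpm : p (midCoord i) = 0 := by simp [p, hmh, hlm.symm]
  have hph : p (hiCoord i) = 1 / 2 := by simp [p]
  rw [← hK.1, Geometry.SimplicialComplex.mem_space_iff] at hpcube
  obtain ⟨s, hs, hps⟩ := hpcube
  have hc : IsChain (· ≤ ·) (s : Set (Fin 3 → ℝ)) := by
    by_contra hc
    obtain ⟨a, b, hab, h⟩ := hK.exists_apply_eq_of_not_isChain hs hc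
    have hpab := apply_eq_of_mem_convexHull hps h
    rcases coord_cases i a with rfl | rfl | rfl <;> rcases coord_cases i b with rfl | rfl | rfl <;>
      first
      | exact hab rfl
      | linarith
  obtain ⟨k, hk⟩ := exists_subset_joinSimplex (hK.2.1 s hs) hc
  refine K.down_closed hs (fun u hu => ?_) (by simp [joinSimplex])
  obtain ⟨huV, hu₁, hu₂⟩ := mem_joinSimplex_iff.1 hu
  refine Separates.mem ⟨fun a b hab => ?_, fun a _ => ?_, fun a _ => ?_⟩ huV hk hps
  · rcases coord_cases i a with rfl | rfl | rfl <;> rcases coord_cases i b with rfl | rfl | rfl <;>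
      linarith
  · rcases coord_cases i a with rfl | rfl | rfl <;> linarith
  · rcases coord_cases i a with rfl | rfl | rfl <;> linarith

theorem faces_eq_joinFaces (hK : IsDiagonalSubdivision K) : K.faces = joinFaces := by
  ext s
  constructor
  · intro hs
    refine ⟨K.nonempty_of_mem_faces hs, exists_subset_joinSimplex (hK.2.1 s hs) ?_⟩
    intro u hu v hv _
    by_contra huv
    simp only [Pi.le_def, not_or, not_forall, not_le] at huv
    obtain ⟨⟨b, hb⟩, a, ha⟩ := huv
    refine inf_sup_notMem_faces hs hu hv ha hb ?_
    obtain ⟨i, hi⟩ := exists_inf_sup_subset_joinSimplex (hK.2.1 s hs hu) (hK.2.1 s hs hv)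
    exact K.down_closed (hK.joinSimplex_mem_faces i) hi (by simp)
  · rintro ⟨hs, i, hi⟩
    exact K.down_closed (hK.joinSimplex_mem_faces i) hi hs

end IsDiagonalSubdivision

/-- The unique simplicial subdivision of the 3-cube respecting the boundary triangulation
`S⁰(x₁₁₁, x₂₂₂) ∗ S¹₆` and adding no new vertices is the join `x₁₁₁x₂₂₂ ∗ S¹₆`, the cone over
the hexagonal 1-sphere through the main diagonal. -/
theorem cube_diagonal_subdivision_unique :
    (∃ K : Geometry.SimplicialComplex ℝ (Fin 3 → ℝ),
      IsDiagonalSubdivision K ∧ K.faces = joinFaces) ∧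
    (∀ K : Geometry.SimplicialComplex ℝ (Fin 3 → ℝ),
      IsDiagonalSubdivision K → K.faces = joinFaces) := by
  exact ⟨⟨joinComplex, isDiagonalSubdivision_joinComplex, rfl⟩, fun _ hK => hK.faces_eq_joinFaces⟩
end
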